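/- arXiv:2603.16324 — 2 statements merged into one kernel-verified Lean document; each statement's English description precedes it below -/
import Mathlib

section
/- Under the gap condition, the canonical flat metric g_Γ is not a maximal point of the normalized first eigenvalue in its conformal class: taking φ := u₁, for every ε > 0 there exists t with 0 < |t| < ε such that λ₁(t)·V_φ(t)^{2/n} > 4π²|w|²·D^{2/n}. -/
open MeasureTheory Real Filter Topology Asymptotics
open scoped InnerProductSpace

noncomputable section

/-- Euclidean space `ℝⁿ`. -/
abbrev E (n : ℕ) := EuclideanSpace ℝ (Fin n)

/-- The vector `A·t ∈ ℝⁿ`. -/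
def matVec {n : ℕ} (A : Matrix (Fin n) (Fin n) ℝ) (t : Fin n → ℝ) : E n :=
  (WithLp.equiv 2 (Fin n → ℝ)).symm (A.mulVec t)

/-- The lattice `Γ = A·ℤⁿ`. -/
def lattice {n : ℕ} (A : Matrix (Fin n) (Fin n) ℝ) : Set (E n) :=
  {x | ∃ m : Fin n → ℤ, x = matVec A fun i => (m i : ℝ)}

/-- The dual lattice `Γ* = {w : ⟨w,x⟩ ∈ ℤ for all x ∈ Γ}`. -/
def dualLattice {n : ℕ} (Γ : Set (E n)) : Set (E n) :=
  {w | ∀ x ∈ Γ, ∃ k : ℤ, ⟪w, x⟫_ℝ = (k : ℝ)}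

/-- `f` is `Γ`-periodic. -/
def IsPeriodic {n : ℕ} (Γ : Set (E n)) (f : E n → ℝ) : Prop :=
  ∀ x : E n, ∀ γ ∈ Γ, f (x + γ) = f x

/-- The fundamental domain `F = A·[0,1)ⁿ`. -/
def fundDomain {n : ℕ} (A : Matrix (Fin n) (Fin n) ℝ) : Set (E n) :=
  {x | ∃ t : Fin n → ℝ, (∀ i, t i ∈ Set.Ico (0:ℝ) 1) ∧ x = matVec A t}

/-- Geometer's (nonnegative) Laplacian: `Δ f = -∑ᵢ ∂²f/∂xᵢ²`. -/
def lap {n : ℕ} (f : E n → ℝ) (x : E n) : ℝ :=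
  -∑ i : Fin n, iteratedFDeriv ℝ 2 f x ![EuclideanSpace.single i 1, EuclideanSpace.single i 1]

/-- The gap condition: `w ∈ Γ* \ {0}` and `|w| < |v|` for every `v ∈ Γ* \ {0, w, -w}`. -/
def GapCondition {n : ℕ} (Γ : Set (E n)) (w : E n) : Prop :=
  w ∈ dualLattice Γ ∧ w ≠ 0 ∧
    ∀ v ∈ dualLattice Γ, v ≠ 0 → v ≠ w → v ≠ -w → ‖w‖ < ‖v‖

/-- `u₁(x) = √2·D^{-1/2}·sin(2π⟨w,x⟩)` where `D = |det A|`. -/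
def uSin {n : ℕ} (A : Matrix (Fin n) (Fin n) ℝ) (w : E n) : E n → ℝ :=
  fun x => Real.sqrt 2 / Real.sqrt |A.det| * Real.sin (2 * π * ⟪w, x⟫_ℝ)

/-- `u₂(x) = √2·D^{-1/2}·cos(2π⟨w,x⟩)` where `D = |det A|`. -/
def uCos {n : ℕ} (A : Matrix (Fin n) (Fin n) ℝ) (w : E n) : E n → ℝ :=
  fun x => Real.sqrt 2 / Real.sqrt |A.det| * Real.cos (2 * π * ⟪w, x⟫_ℝ)

/-- The volume `V_φ(t) = ∫_F e^{ntφ/2} dx` of the conformal metric `e^{tφ}g_Γ`. -/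
def confVol {n : ℕ} (A : Matrix (Fin n) (Fin n) ℝ) (φ : E n → ℝ) (t : ℝ) : ℝ :=
  ∫ x in fundDomain A, Real.exp ((n : ℝ) * t * φ x / 2)

/-- The first positive Laplace eigenvalue `λ₁(t)` of the conformal metric `e^{tφ}g_Γ`,
as the infimum of the Rayleigh quotient over smooth `Γ`-periodic functions that are
not identically zero and have zero mean with respect to the conformal volume measure. -/
def confLam1 {n : ℕ} (A : Matrix (Fin n) (Fin n) ℝ) (φ : E n → ℝ) (t : ℝ) : ℝ :=
  sInf {r : ℝ | ∃ f : E n → ℝ, ContDiff ℝ (⊤ : ℕ∞) f ∧ IsPeriodic (lattice A) f ∧ f ≠ 0 ∧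
    (∫ x in fundDomain A, f x * Real.exp ((n : ℝ) * t * φ x / 2)) = 0 ∧
    r = (∫ x in fundDomain A, ‖gradient f x‖ ^ 2 * Real.exp (((n : ℝ) - 2) * t * φ x / 2)) /
        (∫ x in fundDomain A, (f x) ^ 2 * Real.exp ((n : ℝ) * t * φ x / 2))}

/-- The half-open unit cube `(0,1]ⁿ`. -/
def unitCube (n : ℕ) : Set (Fin n → ℝ) := {t | ∀ i, t i ∈ Set.Ioc (0 : ℝ) (0 + 1)}

/-- The normalized Lebesgue measure on a period cell of the lattice `A·ℤⁿ`. -/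
def cellMeasure {n : ℕ} (A : Matrix (Fin n) (Fin n) ℝ) : Measure (E n) :=
  (volume.restrict (unitCube n)).map (matVec A)

section Cell

variable {n : ℕ} {A : Matrix (Fin n) (Fin n) ℝ}
  {V : Type*} [NormedAddCommGroup V] [NormedSpace ℝ V]

lemma matVec_add (s t : Fin n → ℝ) : matVec A (s + t) = matVec A s + matVec A t := by
  simp [matVec, Matrix.mulVec_add]

lemma continuous_matVec : Continuous (matVec A) := by
  unfold matVec
  exact (PiLp.continuous_toLp 2 _).comp (Continuous.matrix_mulVec continuous_const continuous_id)

lemma matVec_inv_mulVec (hA : IsUnit A.det) (x : E n) :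
    matVec A (A⁻¹.mulVec x.ofLp) = x := by
  simp [matVec, Matrix.mulVec_mulVec, Matrix.mul_nonsing_inv A hA]

lemma matVec_injective (hA : IsUnit A.det) : Function.Injective (matVec A) := by
  intro s t h
  have h' : A.mulVec s = A.mulVec t := (WithLp.equiv 2 (Fin n → ℝ)).symm.injective h
  have := congrArg (A⁻¹.mulVec) h'
  simpa [Matrix.mulVec_mulVec, Matrix.nonsing_inv_mul A hA] using this

lemma unitCube_eq_pi : unitCube n = Set.univ.pi fun _ => Set.Ioc (0 : ℝ) 1 := by
  ext t; simp [unitCube]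

lemma volume_unitCube : volume (unitCube n) = 1 := by
  rw [unitCube_eq_pi, volume_pi_pi]; simp

instance isProbabilityMeasure_cellMeasure : IsProbabilityMeasure (cellMeasure A) := by
  have : IsProbabilityMeasure ((volume : Measure (Fin n → ℝ)).restrict (unitCube n)) :=
    ⟨by simp [volume_unitCube]⟩
  exact Measure.isProbabilityMeasure_map continuous_matVec.measurable.aemeasurable

lemma map_matVec_volume (hA : IsUnit A.det) :
    (volume : Measure (Fin n → ℝ)).map (matVec A) = ENNReal.ofReal |A.det⁻¹| • volume := by
  have h1 := Real.map_matrix_volume_pi_eq_smul_volume_pi (M := A) hA.ne_zero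
  have h2 : (matVec A) = (WithLp.toLp 2) ∘ (Matrix.toLin' A) := by
    ext t; simp [matVec]
  rw [h2, ← Measure.map_map (by fun_prop) (by fun_prop), h1, Measure.map_smul,
    (PiLp.volume_preserving_toLp (Fin n)).map_eq]

lemma restrict_fundDomain (hA : IsUnit A.det) :
    volume.restrict (fundDomain A) = ENNReal.ofReal |A.det| • cellMeasure A := by
  have hF : fundDomain A = (fun x : E n => A⁻¹.mulVec x.ofLp) ⁻¹'
      (Set.univ.pi fun _ => Set.Ico (0 : ℝ) 1) := by
    ext x
    simp only [fundDomain, Set.mem_ofPred_eq, Set.mem_preimage, Set.mem_univ_pi]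
    constructor
    · rintro ⟨t, ht, rfl⟩ i
      simpa [matVec, Matrix.mulVec_mulVec, Matrix.nonsing_inv_mul A hA] using ht i
    · intro h
      exact ⟨_, h, (matVec_inv_mulVec hA x).symm⟩
  have hmeas : MeasurableSet (fundDomain A) := by
    rw [hF]
    refine (Continuous.measurable ?_) (MeasurableSet.univ_pi fun _ => measurableSet_Ico)
    exact Continuous.matrix_mulVec continuous_const (PiLp.continuous_ofLp 2 _)
  have hpre : matVec A ⁻¹' fundDomain A = Set.univ.pi fun _ => Set.Ico (0 : ℝ) 1 := by
    ext t
    simp only [fundDomain, Set.mem_ofPred_eq, Set.mem_preimage, Set.mem_univ_pi]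
    constructor
    · rintro ⟨s, hs, h⟩
      rw [matVec_injective hA h]; exact hs
    · exact fun h => ⟨t, h, rfl⟩
  have hcube : (volume : Measure (Fin n → ℝ)).restrict (unitCube n)
      = volume.restrict (matVec A ⁻¹' fundDomain A) := by
    rw [hpre, unitCube_eq_pi]
    exact Measure.restrict_congr_set (Measure.univ_pi_Ioc_ae_eq_Icc.trans
      (Measure.univ_pi_Ico_ae_eq_Icc (f := fun _ : Fin n => (0 : ℝ))).symm)
  rw [cellMeasure, hcube, ← Measure.restrict_map continuous_matVec.measurable hmeas,
    map_matVec_volume hA, Measure.restrict_smul, smul_smul, ← ENNReal.ofReal_mul (abs_nonneg _),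
    ← abs_mul, mul_inv_cancel₀ hA.ne_zero]
  simp

lemma setIntegral_fundDomain (hA : IsUnit A.det) (g : E n → V) :
    ∫ x in fundDomain A, g x = |A.det| • ∫ x, g x ∂(cellMeasure A) := by
  rw [restrict_fundDomain hA, integral_smul_measure, ENNReal.toReal_ofReal (abs_nonneg _)]

lemma integral_cellMeasure {g : E n → V} (hg : Continuous g) :
    ∫ x, g x ∂(cellMeasure A) = ∫ t in unitCube n, g (matVec A t) := by
  rw [cellMeasure, integral_map continuous_matVec.measurable.aemeasurable
    hg.aestronglyMeasurable]

omit [NormedSpace ℝ V] in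
lemma integrable_cellMeasure {g : E n → V} (hg : Continuous g) :
    Integrable g (cellMeasure A) := by
  rw [cellMeasure, integrable_map_measure hg.aestronglyMeasurable
    continuous_matVec.measurable.aemeasurable]
  have hsub : unitCube n ⊆ Set.univ.pi fun _ => Set.Icc (0 : ℝ) 1 := by
    rw [unitCube_eq_pi]; exact Set.pi_mono fun _ _ => Set.Ioc_subset_Icc_self
  exact ((hg.comp continuous_matVec).continuousOn.integrableOn_compact
    (isCompact_univ_pi fun _ => isCompact_Icc)).mono_set hsub

/-- The representative in `(0,1]ⁿ` of a point of the torus. -/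
def torusRep (y : UnitAddTorus (Fin n)) : Fin n → ℝ := fun i => (AddCircle.equivIoc 1 0 (y i)).1

lemma torusRep_coe (t : Fin n → ℝ) :
    ∃ m : Fin n → ℤ, torusRep (fun i => (t i : UnitAddCircle)) = t + fun i => (m i : ℝ) := by
  have : ∀ i, ∃ m : ℤ, (AddCircle.equivIoc (1 : ℝ) 0 (t i : UnitAddCircle)).1 = t i + m := by
    intro i
    have h : (((AddCircle.equivIoc (1 : ℝ) 0 (t i : UnitAddCircle)).1 : ℝ) : UnitAddCircle) = t i :=
      (AddCircle.equivIoc (1 : ℝ) 0).symm_apply_apply (t i : UnitAddCircle)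
    obtain ⟨m, hm⟩ := QuotientAddGroup.eq_iff_sub_mem.mp h
    refine ⟨m, ?_⟩
    simp only [zsmul_eq_mul, mul_one] at hm
    linarith
  choose m hm using this
  exact ⟨m, funext hm⟩

lemma torusRep_mem (y : UnitAddTorus (Fin n)) : torusRep y ∈ unitCube n := fun i =>
  (AddCircle.equivIoc 1 0 (y i)).2

lemma measurable_torusRep : Measurable (torusRep (n := n)) :=
  measurable_pi_lambda _ fun i => measurable_subtype_coe.comp
    ((AddCircle.measurableEquivIoc 1 0).measurable.comp (measurable_pi_apply i))

lemma periodic_torusRep {α : Type*} {g : E n → α} (hg : ∀ x, ∀ γ ∈ lattice A, g (x + γ) = g x)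
    (t : Fin n → ℝ) : g (matVec A (torusRep fun i => (t i : UnitAddCircle))) = g (matVec A t) := by
  obtain ⟨m, hm⟩ := torusRep_coe t
  rw [hm, matVec_add]
  exact hg _ _ ⟨m, rfl⟩

omit [NormedSpace ℝ V] in
lemma exists_bound_of_periodic (hA : IsUnit A.det) {g : E n → V} (hc : Continuous g)
    (hg : ∀ x, ∀ γ ∈ lattice A, g (x + γ) = g x) : ∃ C, ∀ x, ‖g x‖ ≤ C := by
  obtain ⟨C, hC⟩ := (isCompact_univ_pi fun _ : Fin n =>
    isCompact_Icc (a := (0 : ℝ)) (b := 1)).exists_bound_of_continuousOn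
      (hc.comp (continuous_matVec (A := A))).continuousOn
  refine ⟨C, fun x => ?_⟩
  have h := periodic_torusRep hg (A⁻¹.mulVec x.ofLp)
  rw [matVec_inv_mulVec hA] at h
  rw [← h]
  refine hC _ fun i _ => ?_
  have := torusRep_mem (fun i => ((A⁻¹.mulVec x.ofLp) i : UnitAddCircle)) i
  exact Set.Ioc_subset_Icc_self (by simpa using this)

lemma setIntegral_unitCube_add {G : (Fin n → ℝ) → V}
    (hG : ∀ t, ∀ m : Fin n → ℤ, G (t + fun i => (m i : ℝ)) = G t) (s : Fin n → ℝ) :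
    ∫ t in unitCube n, G (t + s) = ∫ t in unitCube n, G t := by
  have key : ∀ t : Fin n → ℝ, G (torusRep fun i => (t i : UnitAddCircle)) = G t := by
    intro t
    obtain ⟨m, hm⟩ := torusRep_coe t
    rw [hm, hG]
  have h1 := UnitAddTorus.integral_preimage (fun y : UnitAddTorus (Fin n) => G (torusRep y))
    (fun _ => 0)
  have h2 := UnitAddTorus.integral_preimage (fun y : UnitAddTorus (Fin n) =>
    G (torusRep (y + fun i => (s i : UnitAddCircle)))) (fun _ => 0)
  have h3 := h1.symm.trans ((integral_add_right_eq_self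
    (μ := Measure.pi fun _ : Fin n => AddCircle.haarAddCircle (T := 1))
    (fun y : UnitAddTorus (Fin n) => G (torusRep y)) fun i => (s i : UnitAddCircle)).symm.trans h2)
  simp only [key] at h3
  unfold unitCube
  rw [h3]
  refine integral_congr_ae (Eventually.of_forall fun t => ?_)
  exact (key (t + s)).symm

lemma integral_cellMeasure_add {g : E n → V} (hA : IsUnit A.det) (hc : Continuous g)
    (hg : ∀ x, ∀ γ ∈ lattice A, g (x + γ) = g x) (v : E n) :
    ∫ x, g (x + v) ∂(cellMeasure A) = ∫ x, g x ∂(cellMeasure A) := by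
  rw [integral_cellMeasure hc, integral_cellMeasure (by fun_prop)]
  have := setIntegral_unitCube_add (G := fun t => g (matVec A t))
    (fun t m => by rw [matVec_add]; exact hg _ _ ⟨m, rfl⟩) (A⁻¹.mulVec v.ofLp)
  simpa only [matVec_add, matVec_inv_mulVec hA] using this

lemma fderiv_periodic {g : E n → V} (hg : ∀ x, ∀ γ ∈ lattice A, g (x + γ) = g x) :
    ∀ x, ∀ γ ∈ lattice A, fderiv ℝ g (x + γ) = fderiv ℝ g x := by
  intro x γ hγ
  rw [← fderiv_comp_add_right]
  congr 1
  ext y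
  exact hg y γ hγ

/-- The mean of a directional derivative of a periodic function vanishes. -/
lemma integral_fderiv_cellMeasure [CompleteSpace V] (hA : IsUnit A.det) {g : E n → V}
    (hc : ContDiff ℝ 1 g) (hg : ∀ x, ∀ γ ∈ lattice A, g (x + γ) = g x) (v : E n) :
    ∫ x, fderiv ℝ g x v ∂(cellMeasure A) = 0 := by
  have hc' : Continuous (fderiv ℝ g) := hc.continuous_fderiv (by simp)
  obtain ⟨C, hC⟩ := exists_bound_of_periodic hA hc' (fderiv_periodic hg)
  have hd := hasDerivAt_integral_of_dominated_loc_of_deriv_le (μ := cellMeasure A)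
    (F := fun (s : ℝ) x => g (x + s • v)) (F' := fun s x => fderiv ℝ g (x + s • v) v)
    (x₀ := 0) (s := Set.univ) (bound := fun _ => C * ‖v‖) univ_mem
    (Eventually.of_forall fun s => (hc.continuous.comp (by fun_prop)).aestronglyMeasurable)
    (integrable_cellMeasure (hc.continuous.comp (by fun_prop)))
    (Continuous.aestronglyMeasurable (by fun_prop))
    (Eventually.of_forall fun x s _ => (ContinuousLinearMap.le_opNorm _ _).trans (by
      gcongr; exact hC _))
    (integrable_const _)
    (Eventually.of_forall fun x s _ => by
      have h1 : HasFDerivAt g (fderiv ℝ g (x + s • v)) (x + s • v) :=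
        (hc.differentiable (by simp) _).hasFDerivAt
      have h2 : HasDerivAt (fun s : ℝ => x + s • v) v s := by
        simpa using ((hasDerivAt_id s).smul_const v).const_add x
      exact h1.comp_hasDerivAt s h2)
  have hconst : (fun s : ℝ => ∫ x, g (x + s • v) ∂(cellMeasure A))
      = fun _ => ∫ x, g x ∂(cellMeasure A) := by
    ext s; exact integral_cellMeasure_add hA hc.continuous hg _
  have h := hd.2
  rw [hconst] at h
  simpa using h.unique (hasDerivAt_const _ _)

end Cell

section Fourier

variable {n : ℕ} {A : Matrix (Fin n) (Fin n) ℝ}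

/-- The vector `A⁻ᵀ·m` of the dual lattice. -/
def dualVec (A : Matrix (Fin n) (Fin n) ℝ) (m : Fin n → ℤ) : E n :=
  matVec (A⁻¹).transpose fun i => (m i : ℝ)

/-- The character `x ↦ exp(-2πi⟨v,x⟩)`. -/
def latChar (v : E n) (x : E n) : ℂ := Complex.exp (((-(2 * π * ⟪v, x⟫_ℝ) : ℝ) : ℂ) * Complex.I)

lemma inner_matVec (B : Matrix (Fin n) (Fin n) ℝ) (s t : Fin n → ℝ) :
    ⟪matVec B s, matVec A t⟫_ℝ = dotProduct ((A.transpose * B).mulVec s) t := by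
  have : ⟪matVec B s, matVec A t⟫_ℝ = dotProduct (B.mulVec s) (A.mulVec t) := by
    simp [matVec, EuclideanSpace.inner_eq_star_dotProduct, dotProduct_comm]
  rw [this, Matrix.dotProduct_mulVec, ← Matrix.mulVec_transpose, Matrix.mulVec_mulVec]

lemma inner_dualVec (hA : IsUnit A.det) (m : Fin n → ℤ) (t : Fin n → ℝ) :
    ⟪dualVec A m, matVec A t⟫_ℝ = ∑ i, (m i : ℝ) * t i := by
  rw [dualVec, inner_matVec, ← Matrix.transpose_mul, Matrix.nonsing_inv_mul A hA]
  simp [dotProduct]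

lemma dualVec_mem (hA : IsUnit A.det) (m : Fin n → ℤ) :
    dualVec A m ∈ dualLattice (lattice A) := by
  rintro x ⟨k, rfl⟩
  exact ⟨∑ i, m i * k i, by rw [inner_dualVec hA]; push_cast; rfl⟩

lemma latChar_periodic {v : E n} (hv : v ∈ dualLattice (lattice A)) :
    ∀ x, ∀ γ ∈ lattice A, latChar v (x + γ) = latChar v x := by
  intro x γ hγ
  obtain ⟨k, hk⟩ := hv γ hγ
  rw [latChar, latChar, inner_add_right, hk, Complex.exp_eq_exp_iff_exists_int]
  exact ⟨-k, by push_cast; ring⟩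

lemma contDiff_latChar (v : E n) : ContDiff ℝ (⊤ : ℕ∞) (latChar v) := by
  unfold latChar
  have h : ContDiff ℝ (⊤ : ℕ∞) fun x : E n => (-(2 * π * ⟪v, x⟫_ℝ) : ℝ) :=
    (contDiff_const.mul (contDiff_const.inner ℝ contDiff_id)).neg
  have h2 : ContDiff ℝ (⊤ : ℕ∞) fun x : E n => ((-(2 * π * ⟪v, x⟫_ℝ) : ℝ) : ℂ) :=
    Complex.ofRealCLM.contDiff.comp h
  exact Complex.contDiff_exp.comp (h2.mul contDiff_const)

lemma hasFDerivAt_latChar (v x u : E n) :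
    fderiv ℝ (latChar v) x u = -((2 * π * ⟪v, u⟫_ℝ : ℝ) : ℂ) * Complex.I * latChar v x := by
  have hd : HasDerivAt (fun s : ℝ => latChar v (x + s • u))
      (fderiv ℝ (latChar v) x u) 0 := by
    have h1 : HasFDerivAt (latChar v) (fderiv ℝ (latChar v) x) (x + (0 : ℝ) • u) := by
      rw [zero_smul, add_zero]
      exact ((contDiff_latChar v).differentiable (by simp) x).hasFDerivAt
    have h2 : HasDerivAt (fun s : ℝ => x + s • u) u 0 := by
      simpa using ((hasDerivAt_id (0 : ℝ)).smul_const u).const_add x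
    exact h1.comp_hasDerivAt 0 h2
  have hd2 : HasDerivAt (fun s : ℝ => latChar v (x + s • u))
      (-((2 * π * ⟪v, u⟫_ℝ : ℝ) : ℂ) * Complex.I * latChar v x) 0 := by
    have e : (fun s : ℝ => latChar v (x + s • u)) = fun s : ℝ =>
        Complex.exp (((-(2 * π * (⟪v, x⟫_ℝ + s * ⟪v, u⟫_ℝ)) : ℝ) : ℂ) * Complex.I) := by
      ext s
      rw [latChar, inner_add_right, inner_smul_right]
    rw [e]
    have h3 : HasDerivAt (fun s : ℝ => -(2 * π * (⟪v, x⟫_ℝ + s * ⟪v, u⟫_ℝ)))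
        (-(2 * π * ⟪v, u⟫_ℝ)) 0 := by
      have := (((hasDerivAt_id (0 : ℝ)).mul_const ⟪v, u⟫_ℝ).const_add ⟪v, x⟫_ℝ).const_mul (2 * π)
      exact (by simpa using this : HasDerivAt _ (2 * π * ⟪v, u⟫_ℝ) _).neg
    have h4 := (h3.ofReal_comp.mul_const Complex.I).cexp
    convert h4 using 1
    simp only [zero_mul, add_zero, latChar]
    push_cast
    ring
  exact hd.unique hd2

/-- **Parseval's identity** on the torus `ℝⁿ/A·ℤⁿ`. -/
lemma hasSum_sq_latChar_coeff (hA : IsUnit A.det) {f : E n → ℝ} (hc : Continuous f)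
    (hf : IsPeriodic (lattice A) f) :
    HasSum (fun m => ‖∫ x, (f x : ℂ) * latChar (dualVec A m) x ∂(cellMeasure A)‖ ^ 2)
      (∫ x, f x ^ 2 ∂(cellMeasure A)) := by
  set μT : Measure (UnitAddTorus (Fin n)) :=
    Measure.pi fun _ : Fin n => AddCircle.haarAddCircle (T := 1) with hμT
  set G : UnitAddTorus (Fin n) → ℂ := fun y => (f (matVec A (torusRep y)) : ℂ) with hG
  obtain ⟨C, hC⟩ := exists_bound_of_periodic hA hc hf
  have hmeas : Measurable G := Complex.measurable_ofReal.comp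
    (hc.measurable.comp (continuous_matVec.measurable.comp measurable_torusRep))
  have hL : MemLp G 2 μT := MemLp.of_bound hmeas.aestronglyMeasurable C
    (Eventually.of_forall fun y => by simpa [hG] using hC _)
  have hae := hL.coeFn_toLp
  have key := UnitAddTorus.hasSum_sq_mFourierCoeff (hL.toLp G)
  have hcoef : ∀ m, UnitAddTorus.mFourierCoeff (hL.toLp G) m
      = ∫ x, (f x : ℂ) * latChar (dualVec A m) x ∂(cellMeasure A) := by
    intro m
    have h1 : UnitAddTorus.mFourierCoeff (hL.toLp G) m = UnitAddTorus.mFourierCoeff G m := by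
      refine integral_congr_ae ?_
      filter_upwards [hae] with y hy
      rw [hy]
    have hcm : Continuous fun x => (f x : ℂ) * latChar (dualVec A m) x := by
      have := (contDiff_latChar (dualVec A m)).continuous
      fun_prop
    rw [h1, UnitAddTorus.mFourierCoeff_eq_integral G m (fun _ => 0),
      integral_cellMeasure hcm]
    refine integral_congr_ae (Eventually.of_forall fun t => ?_)
    have h2 : G (fun i => (t i : UnitAddCircle)) = (f (matVec A t) : ℂ) := by
      simp only [hG]
      rw [periodic_torusRep hf]
    simp only [h2, smul_eq_mul]
    rw [mul_comm, latChar, inner_dualVec hA]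
    congr 1
    simp only [UnitAddTorus.mFourier, ContinuousMap.coe_mk, fourier_coe_apply, Pi.neg_apply]
    rw [← Complex.exp_sum]
    congr 1
    push_cast
    rw [Finset.mul_sum, ← Finset.sum_neg_distrib, Finset.sum_mul]
    refine Finset.sum_congr rfl fun i _ => ?_
    ring
  have hnorm : ∫ y, ‖(hL.toLp G) y‖ ^ 2 ∂μT = ∫ x, f x ^ 2 ∂(cellMeasure A) := by
    have h1 : ∫ y, ‖(hL.toLp G) y‖ ^ 2 ∂μT = ∫ y, ‖G y‖ ^ 2 ∂μT := by
      refine integral_congr_ae ?_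
      filter_upwards [hae] with y hy
      rw [hy]
    rw [h1, integral_cellMeasure (by fun_prop)]
    refine (UnitAddTorus.integral_preimage (fun y => ‖G y‖ ^ 2) (fun _ => 0)).trans ?_
    refine integral_congr_ae (Eventually.of_forall fun t => ?_)
    simp only [hG]
    rw [periodic_torusRep hf]
    simp
  have key2 : HasSum (fun m => ‖UnitAddTorus.mFourierCoeff (hL.toLp G) m‖ ^ 2)
    (∫ y, ‖(hL.toLp G) y‖ ^ 2 ∂μT) := key
  rw [hnorm] at key2
  simpa only [hcoef] using key2

lemma latChar_coeff_fderiv (hA : IsUnit A.det) {f : E n → ℝ} (hc : ContDiff ℝ (⊤ : ℕ∞) f)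
    (hf : IsPeriodic (lattice A) f) (m : Fin n → ℤ) (u : E n) :
    ∫ x, ((fderiv ℝ f x u : ℝ) : ℂ) * latChar (dualVec A m) x ∂(cellMeasure A)
      = ((2 * π * ⟪dualVec A m, u⟫_ℝ : ℝ) : ℂ) * Complex.I *
        ∫ x, (f x : ℂ) * latChar (dualVec A m) x ∂(cellMeasure A) := by
  set v := dualVec A m
  have hχ := contDiff_latChar v
  have hfC : ContDiff ℝ (⊤ : ℕ∞) fun x => (f x : ℂ) := Complex.ofRealCLM.contDiff.comp hc
  have h0 := integral_fderiv_cellMeasure hA (g := fun x => (f x : ℂ) * latChar v x)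
    ((hfC.mul hχ).of_le (by norm_cast)) (fun x γ hγ => by
      simp only [hf x γ hγ, latChar_periodic (dualVec_mem hA m) x γ hγ, v]) u
  have hd : ∀ x, fderiv ℝ (fun x => (f x : ℂ) * latChar v x) x u
      = ((fderiv ℝ f x u : ℝ) : ℂ) * latChar v x
        - ((2 * π * ⟪v, u⟫_ℝ : ℝ) : ℂ) * Complex.I * ((f x : ℂ) * latChar v x) := by
    intro x
    have hf' : HasFDerivAt f (fderiv ℝ f x) x := (hc.differentiable (by simp) x).hasFDerivAt
    have h1 := (Complex.ofRealCLM.hasFDerivAt (x := f x)).comp x hf'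
    have h2 : HasFDerivAt (latChar v) (fderiv ℝ (latChar v) x) x :=
      (hχ.differentiable (by simp) x).hasFDerivAt
    have h3 := (h1.mul h2).fderiv
    change fderiv ℝ (fun x => (f x : ℂ) * latChar v x) x = _ at h3
    rw [h3]
    simp [hasFDerivAt_latChar]
    ring_nf
  simp only [hd] at h0
  rw [integral_sub, integral_const_mul, sub_eq_zero] at h0
  · exact h0
  · refine integrable_cellMeasure ((Complex.continuous_ofReal.comp ?_).mul hχ.continuous)
    exact (hc.continuous_fderiv (by simp)).clm_apply continuous_const
  · exact integrable_cellMeasure (continuous_const.mul (hfC.continuous.mul hχ.continuous))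

lemma norm_gradient_sq {f : E n → ℝ} (x : E n) :
    ‖gradient f x‖ ^ 2 = ∑ j, (fderiv ℝ f x (EuclideanSpace.single j 1)) ^ 2 := by
  rw [EuclideanSpace.norm_sq_eq]
  refine Finset.sum_congr rfl fun j _ => ?_
  have : fderiv ℝ f x (EuclideanSpace.single j 1) = (gradient f x) j := by
    have h := InnerProductSpace.toDual_symm_apply (𝕜 := ℝ) (x := EuclideanSpace.single j (1 : ℝ))
      (y := fderiv ℝ f x)
    rw [← h, gradient, EuclideanSpace.inner_single_right]
    simp
  rw [this, Real.norm_eq_abs, sq_abs]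

lemma hasSum_gradient_sq (hA : IsUnit A.det) {f : E n → ℝ} (hc : ContDiff ℝ (⊤ : ℕ∞) f)
    (hf : IsPeriodic (lattice A) f) :
    HasSum (fun m => 4 * π ^ 2 * ‖dualVec A m‖ ^ 2 *
        ‖∫ x, (f x : ℂ) * latChar (dualVec A m) x ∂(cellMeasure A)‖ ^ 2)
      (∫ x, ‖gradient f x‖ ^ 2 ∂(cellMeasure A)) := by
  have hcont : ∀ u, Continuous fun x => fderiv ℝ f x u := fun u =>
    (hc.continuous_fderiv (by simp)).clm_apply continuous_const
  have h1 : ∀ j : Fin n, HasSum (fun m => 4 * π ^ 2 * (dualVec A m j) ^ 2 *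
        ‖∫ x, (f x : ℂ) * latChar (dualVec A m) x ∂(cellMeasure A)‖ ^ 2)
      (∫ x, (fderiv ℝ f x (EuclideanSpace.single j 1)) ^ 2 ∂(cellMeasure A)) := by
    intro j
    have := hasSum_sq_latChar_coeff hA (hcont (EuclideanSpace.single j 1))
      (fun x γ hγ => by simp only [fderiv_periodic hf x γ hγ])
    refine this.congr_fun fun m => ?_
    rw [latChar_coeff_fderiv hA hc hf, norm_mul, norm_mul, Complex.norm_I, Complex.norm_real,
      EuclideanSpace.inner_single_right, Real.norm_eq_abs, mul_pow, mul_one, sq_abs]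
    simp only [conj_trivial, one_mul]
    ring
  have h2 := hasSum_sum (s := Finset.univ) fun j _ => h1 j
  rw [← integral_finsetSum _ fun j _ => (integrable_cellMeasure ((hcont _).pow 2) :
    Integrable (fun x => (fderiv ℝ f x _) ^ 2) _)] at h2
  simp only [← norm_gradient_sq] at h2
  refine h2.congr_fun fun m => ?_
  rw [EuclideanSpace.norm_sq_eq, Finset.mul_sum, Finset.sum_mul]
  simp

/-- Finitely many dual lattice vectors lie in a given ball. -/
lemma finite_dualVec_norm_le (hA : IsUnit A.det) (R : ℝ) :
    {m : Fin n → ℤ | ‖dualVec A m‖ ≤ R}.Finite := by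
  have hb : ∀ i : Fin n, ∀ m ∈ {m : Fin n → ℤ | ‖dualVec A m‖ ≤ R},
      |(m i : ℝ)| ≤ R * ‖matVec A (Pi.single i 1)‖ := by
    intro i m hm
    have h := inner_dualVec hA m (Pi.single i 1)
    simp [Pi.single_apply] at h
    rw [← h]
    exact (abs_real_inner_le_norm _ _).trans
      (mul_le_mul_of_nonneg_right hm (norm_nonneg _))
  refine (Set.Finite.pi' (t := fun i => Set.Icc (-⌈R * ‖matVec A (Pi.single i 1)‖⌉)
    ⌈R * ‖matVec A (Pi.single i 1)‖⌉) fun i => Set.finite_Icc _ _).subset fun m hm i => ?_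
  have h := abs_le.mp (hb i m hm)
  have hle := Int.le_ceil (R * ‖matVec A (Pi.single i 1)‖)
  constructor
  · have : (-(⌈R * ‖matVec A (Pi.single i 1)‖⌉ : ℤ) : ℝ) ≤ m i := by linarith
    exact_mod_cast this
  · have : (m i : ℝ) ≤ (⌈R * ‖matVec A (Pi.single i 1)‖⌉ : ℤ) := by linarith
    exact_mod_cast this

lemma exists_spectral_gap (hA : IsUnit A.det) {w : E n} (hgap : GapCondition (lattice A) w) :
    ∃ Λ > ‖w‖ ^ 2, ∀ m, dualVec A m ≠ 0 → dualVec A m ≠ w → dualVec A m ≠ -w →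
      Λ ≤ ‖dualVec A m‖ ^ 2 := by
  obtain ⟨-, -, hlt⟩ := hgap
  set S := {m : Fin n → ℤ | ‖dualVec A m‖ ≤ ‖w‖ + 1} ∩
    {m | dualVec A m ≠ 0 ∧ dualVec A m ≠ w ∧ dualVec A m ≠ -w} with hS
  have hfin : S.Finite := (finite_dualVec_norm_le hA _).inter_of_left _
  obtain ⟨r, hr1, hr2⟩ : ∃ r > ‖w‖, ∀ m ∈ S, r ≤ ‖dualVec A m‖ := by
    rcases S.eq_empty_or_nonempty with h | h
    · exact ⟨‖w‖ + 1, by simp, by simp [h]⟩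
    · obtain ⟨m₀, hm₀, hmin⟩ := hfin.exists_minimalFor (fun m => ‖dualVec A m‖) S h
      refine ⟨‖dualVec A m₀‖, hlt _ (dualVec_mem hA m₀) hm₀.2.1 hm₀.2.2.1 hm₀.2.2.2,
        fun m hm => ?_⟩
      by_contra hcon
      exact hcon (hmin hm (not_le.mp hcon).le)
  refine ⟨(min r (‖w‖ + 1)) ^ 2, ?_, fun m h0 h1 h2 => ?_⟩
  · exact pow_lt_pow_left₀ (lt_min hr1 (by simp)) (norm_nonneg _) (by norm_num)
  · refine pow_le_pow_left₀ (le_min ((norm_nonneg _).trans hr1.le) (by positivity)) ?_ 2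
    by_cases hm : ‖dualVec A m‖ ≤ ‖w‖ + 1
    · exact (min_le_left _ _).trans (hr2 m ⟨hm, h0, h1, h2⟩)
    · exact (min_le_right _ _).trans (not_le.mp hm).le

/-- The Poincaré inequality for periodic functions orthogonal to the modes `0, ±w`. -/
lemma poincare_of_orthogonal (hA : IsUnit A.det) {w : E n} {Λ : ℝ}
    (hΛ : ∀ m, dualVec A m ≠ 0 → dualVec A m ≠ w → dualVec A m ≠ -w → Λ ≤ ‖dualVec A m‖ ^ 2)
    {f : E n → ℝ} (hc : ContDiff ℝ (⊤ : ℕ∞) f) (hf : IsPeriodic (lattice A) f)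
    (h0 : ∫ x, f x ∂(cellMeasure A) = 0)
    (hs : ∫ x, f x * Real.sin (2 * π * ⟪w, x⟫_ℝ) ∂(cellMeasure A) = 0)
    (hcos : ∫ x, f x * Real.cos (2 * π * ⟪w, x⟫_ℝ) ∂(cellMeasure A) = 0) :
    4 * π ^ 2 * Λ * ∫ x, f x ^ 2 ∂(cellMeasure A)
      ≤ ∫ x, ‖gradient f x‖ ^ 2 ∂(cellMeasure A) := by
  refine hasSum_le (fun m => ?_) ((hasSum_sq_latChar_coeff hA hc.continuous hf).mul_left _)
    (hasSum_gradient_sq hA hc hf)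
  have hfc := hc.continuous
  have hsplit : ∀ ε : ℝ, (ε = 1 ∨ ε = -1) →
      ∫ x, (f x : ℂ) * latChar (ε • w) x ∂(cellMeasure A) = 0 := by
    intro ε hε
    have e : ∀ x, (f x : ℂ) * latChar (ε • w) x
        = ((f x * Real.cos (2 * π * ⟪w, x⟫_ℝ) : ℝ) : ℂ)
          + ((f x * Real.sin (2 * π * ⟪w, x⟫_ℝ) : ℝ) : ℂ) * (-ε * Complex.I) := by
      intro x
      rw [latChar, inner_smul_left, Complex.exp_mul_I, ← Complex.ofReal_cos, ← Complex.ofReal_sin]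
      rcases hε with rfl | rfl
      · simp; ring
      · simp; ring
    simp only [e]
    rw [integral_add, integral_mul_const, integral_complex_ofReal, integral_complex_ofReal, hs, hcos]
    · simp
    · exact integrable_cellMeasure (by fun_prop)
    · exact integrable_cellMeasure (by fun_prop)
  by_cases hz : dualVec A m = 0 ∨ dualVec A m = w ∨ dualVec A m = -w
  · have hcz : ∫ x, (f x : ℂ) * latChar (dualVec A m) x ∂(cellMeasure A) = 0 := by
      rcases hz with h | h | h
      · rw [h]
        simp only [latChar, inner_zero_left]
        simp only [mul_zero, neg_zero, Complex.ofReal_zero, zero_mul, Complex.exp_zero, mul_one]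
        rw [integral_complex_ofReal, h0, Complex.ofReal_zero]
      · rw [h]; simpa using hsplit 1 (Or.inl rfl)
      · rw [h]; simpa using hsplit (-1) (Or.inr rfl)
    simp [hcz]
  · push Not at hz
    have := hΛ m hz.1 hz.2.1 hz.2.2
    gcongr

end Fourier

section Phase

variable {n : ℕ} {A : Matrix (Fin n) (Fin n) ℝ} {w : E n}

/-- The phase `2π⟨w,x⟩`. -/
def phase (w x : E n) : ℝ := 2 * π * ⟪w, x⟫_ℝ

lemma contDiff_phase : ContDiff ℝ (⊤ : ℕ∞) (phase w) :=
  contDiff_const.mul (contDiff_const.inner ℝ contDiff_id)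

@[fun_prop]
lemma continuous_phase : Continuous (phase w) := contDiff_phase.continuous

lemma hasFDerivAt_phase (x : E n) :
    HasFDerivAt (phase w) ((2 * π) • innerSL ℝ w) x :=
  ((innerSL ℝ w).hasFDerivAt).const_mul (2 * π)

lemma isPeriodic_comp_phase (hw : w ∈ dualLattice (lattice A)) {ψ : ℝ → ℝ}
    (hψ : Function.Periodic ψ (2 * π)) : IsPeriodic (lattice A) fun x => ψ (phase w x) := by
  intro x γ hγ
  obtain ⟨k, hk⟩ := hw γ hγ
  have : phase w (x + γ) = phase w x + k * (2 * π) := by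
    rw [phase, phase, inner_add_right, hk]; ring
  simp only [this]
  exact hψ.int_mul k _

/-- Integration by parts in the direction `w`. -/
lemma integral_comp_phase_mul_fderiv (hA : IsUnit A.det) (hw : w ∈ dualLattice (lattice A))
    {ψ ψ' : ℝ → ℝ} (hd : ∀ u, HasDerivAt ψ (ψ' u) u) (hc : Continuous ψ')
    (hψ : Function.Periodic ψ (2 * π)) {h : E n → ℝ} (hh : ContDiff ℝ (⊤ : ℕ∞) h)
    (hper : IsPeriodic (lattice A) h) :
    ∫ x, ψ (phase w x) * fderiv ℝ h x w ∂(cellMeasure A)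
      = -(2 * π * ‖w‖ ^ 2) * ∫ x, ψ' (phase w x) * h x ∂(cellMeasure A) := by
  have hψ1 : ContDiff ℝ 1 ψ := contDiff_one_iff_deriv.mpr
    ⟨fun u => (hd u).differentiableAt, by rwa [funext fun u => (hd u).deriv]⟩
  have hg : ContDiff ℝ 1 fun x => ψ (phase w x) * h x :=
    (hψ1.comp (contDiff_phase.of_le (by norm_cast))).mul (hh.of_le (by norm_cast))
  have h0 := integral_fderiv_cellMeasure hA hg (fun x γ hγ => by
    have h1 : ψ (phase w (x + γ)) = ψ (phase w x) := isPeriodic_comp_phase hw hψ x γ hγ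
    rw [h1, hper x γ hγ]) w
  have hfd : ∀ x, fderiv ℝ (fun x => ψ (phase w x) * h x) x w
      = ψ (phase w x) * fderiv ℝ h x w + (2 * π * ‖w‖ ^ 2) * (ψ' (phase w x) * h x) := by
    intro x
    have h1 : HasFDerivAt (fun x => ψ (phase w x)) (ψ' (phase w x) • ((2 * π) • innerSL ℝ w)) x :=
      (hd _).comp_hasFDerivAt x (hasFDerivAt_phase x)
    have h2 : HasFDerivAt h (fderiv ℝ h x) x := (hh.differentiable (by simp) x).hasFDerivAt
    have h3 := (h1.mul h2).fderiv
    change fderiv ℝ (fun x => ψ (phase w x) * h x) x = _ at h3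
    rw [h3]
    simp
    ring
  have hfc : Continuous fun x => fderiv ℝ h x w :=
    (hh.continuous_fderiv (by simp)).clm_apply continuous_const
  have hψc := hψ1.continuous
  have hhc := hh.continuous
  simp only [hfd] at h0
  rw [integral_add (integrable_cellMeasure (by fun_prop)) (integrable_cellMeasure (by fun_prop)),
    integral_const_mul] at h0
  linarith

lemma integral_deriv_comp_phase (hA : IsUnit A.det) (hw : w ∈ dualLattice (lattice A))
    (hw0 : w ≠ 0) {ψ ψ' : ℝ → ℝ} (hd : ∀ u, HasDerivAt ψ (ψ' u) u) (hc : Continuous ψ')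
    (hψ : Function.Periodic ψ (2 * π)) :
    ∫ x, ψ' (phase w x) ∂(cellMeasure A) = 0 := by
  have h := integral_comp_phase_mul_fderiv hA hw hd hc hψ (h := fun _ => 1) contDiff_const
    (fun _ _ _ => rfl)
  have hw' : 0 < ‖w‖ := norm_pos_iff.mpr hw0
  simpa [Real.pi_ne_zero, hw0] using h

/-- The mean over a period cell of a function of the phase. -/
def phaseMean (A : Matrix (Fin n) (Fin n) ℝ) (w : E n) (ψ : ℝ → ℝ) : ℝ :=
  ∫ x, ψ (phase w x) ∂(cellMeasure A)

lemma phaseMean_add {f g : ℝ → ℝ} (hf : Continuous f) (hg : Continuous g) :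
    phaseMean A w (fun u => f u + g u) = phaseMean A w f + phaseMean A w g :=
  integral_add (integrable_cellMeasure (by fun_prop)) (integrable_cellMeasure (by fun_prop))

lemma phaseMean_const_mul (r : ℝ) (f : ℝ → ℝ) :
    phaseMean A w (fun u => r * f u) = r * phaseMean A w f :=
  integral_const_mul _ _

lemma phaseMean_const (r : ℝ) : phaseMean A w (fun _ => r) = r := by
  simp [phaseMean]

lemma phaseMean_mono {f g : ℝ → ℝ} (hf : Continuous f) (hg : Continuous g)
    (h : ∀ u, f u ≤ g u) : phaseMean A w f ≤ phaseMean A w g :=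
  integral_mono (integrable_cellMeasure (by fun_prop)) (integrable_cellMeasure (by fun_prop))
    fun x => h _

section Moments

variable (hA : IsUnit A.det) (hw : w ∈ dualLattice (lattice A)) (hw0 : w ≠ 0)
include hA hw hw0

lemma phaseMean_cos : phaseMean A w cos = 0 :=
  integral_deriv_comp_phase hA hw hw0 Real.hasDerivAt_sin (by fun_prop) Real.sin_periodic

lemma phaseMean_sin : phaseMean A w sin = 0 := by
  refine integral_deriv_comp_phase hA hw hw0 (ψ := fun u => -cos u) (fun u => ?_) (by fun_prop)
    (fun u => by simp)
  convert! (Real.hasDerivAt_cos u).neg using 1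
  simp

lemma phaseMean_sin_mul_cos : phaseMean A w (fun u => sin u * cos u) = 0 := by
  refine integral_deriv_comp_phase hA hw hw0 (ψ := fun u => sin u ^ 2 / 2)
    (ψ' := fun u => sin u * cos u) (fun u => ?_) (by fun_prop) (fun u => by simp)
  convert! ((Real.hasDerivAt_sin u).pow 2).div_const 2 using 1
  simp; ring

lemma phaseMean_sin_sq : phaseMean A w (fun u => sin u ^ 2) = 1 / 2 := by
  have h : phaseMean A w (fun u => 2 * sin u ^ 2 + -1) = 0 := by
    refine integral_deriv_comp_phase hA hw hw0 (ψ := fun u => -(sin u * cos u))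
      (ψ' := fun u => 2 * sin u ^ 2 + -1) (fun u => ?_) (by fun_prop) (fun u => by simp)
    convert! ((Real.hasDerivAt_sin u).mul (Real.hasDerivAt_cos u)).neg using 1
    nlinarith [Real.sin_sq_add_cos_sq u]
  rw [phaseMean_add (by fun_prop) (by fun_prop), phaseMean_const_mul, phaseMean_const] at h
  linarith

lemma phaseMean_cos_sq : phaseMean A w (fun u => cos u ^ 2) = 1 / 2 := by
  have e : (fun u => cos u ^ 2) = fun u => 1 + (-1) * sin u ^ 2 := by
    ext u; rw [Real.cos_sq']; ring
  rw [e, phaseMean_add (by fun_prop) (by fun_prop), phaseMean_const_mul, phaseMean_const,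
    phaseMean_sin_sq hA hw hw0]
  norm_num

lemma phaseMean_sin_sq_mul_cos : phaseMean A w (fun u => sin u ^ 2 * cos u) = 0 := by
  refine integral_deriv_comp_phase hA hw hw0 (ψ := fun u => sin u ^ 3 / 3)
    (ψ' := fun u => sin u ^ 2 * cos u) (fun u => ?_) (by fun_prop) (fun u => by simp)
  convert! ((Real.hasDerivAt_sin u).pow 3).div_const 3 using 1
  simp; ring

lemma phaseMean_sin_mul_cos_sq : phaseMean A w (fun u => sin u * cos u ^ 2) = 0 := by
  refine integral_deriv_comp_phase hA hw hw0 (ψ := fun u => -(cos u ^ 3 / 3))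
    (ψ' := fun u => sin u * cos u ^ 2) (fun u => ?_) (by fun_prop) (fun u => by simp)
  convert! (((Real.hasDerivAt_cos u).pow 3).div_const 3).neg using 1
  simp; ring

lemma phaseMean_sin_cube : phaseMean A w (fun u => sin u ^ 3) = 0 := by
  have e : (fun u => sin u ^ 3) = fun u => sin u + (-1) * (sin u * cos u ^ 2) := by
    ext u; rw [Real.cos_sq']; ring
  rw [e, phaseMean_add (by fun_prop) (by fun_prop), phaseMean_const_mul,
    phaseMean_sin_mul_cos_sq hA hw hw0]
  simpa using phaseMean_sin hA hw hw0

lemma phaseMean_sin_cube_mul_cos : phaseMean A w (fun u => sin u ^ 3 * cos u) = 0 := by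
  refine integral_deriv_comp_phase hA hw hw0 (ψ := fun u => sin u ^ 4 / 4)
    (ψ' := fun u => sin u ^ 3 * cos u) (fun u => ?_) (by fun_prop) (fun u => by simp)
  convert! ((Real.hasDerivAt_sin u).pow 4).div_const 4 using 1
  simp; ring

lemma phaseMean_sin_pow_four : phaseMean A w (fun u => sin u ^ 4) = 3 / 8 := by
  have h : phaseMean A w (fun u => 4 * sin u ^ 4 + (-3) * sin u ^ 2) = 0 := by
    refine integral_deriv_comp_phase hA hw hw0 (ψ := fun u => -(sin u ^ 3 * cos u))
      (ψ' := fun u => 4 * sin u ^ 4 + (-3) * sin u ^ 2) (fun u => ?_) (by fun_prop)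
      (fun u => by simp)
    convert! (((Real.hasDerivAt_sin u).pow 3).mul (Real.hasDerivAt_cos u)).neg using 1
    simp
    linear_combination (3 * sin u ^ 2) * Real.sin_sq_add_cos_sq u
  rw [phaseMean_add (by fun_prop) (by fun_prop), phaseMean_const_mul, phaseMean_const_mul,
    phaseMean_sin_sq hA hw hw0] at h
  linarith

lemma phaseMean_sin_sq_mul_cos_sq : phaseMean A w (fun u => sin u ^ 2 * cos u ^ 2) = 1 / 8 := by
  have e : (fun u => sin u ^ 2 * cos u ^ 2) = fun u => sin u ^ 2 + (-1) * sin u ^ 4 := by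
    ext u; rw [Real.cos_sq']; ring
  rw [e, phaseMean_add (by fun_prop) (by fun_prop), phaseMean_const_mul,
    phaseMean_sin_sq hA hw hw0, phaseMean_sin_pow_four hA hw hw0]
  norm_num

end Moments

lemma gradient_phase_add {L L' : ℝ → ℝ} (hd : ∀ u, HasDerivAt L (L' u) u) {h : E n → ℝ}
    (hh : Differentiable ℝ h) (x : E n) :
    gradient (fun x => L (phase w x) + h x) x
      = (2 * π * L' (phase w x)) • w + gradient h x := by
  have h1 : HasFDerivAt (fun x => L (phase w x)) (L' (phase w x) • ((2 * π) • innerSL ℝ w)) x :=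
    (hd _).comp_hasFDerivAt x (hasFDerivAt_phase x)
  have h2 : fderiv ℝ (fun x => L (phase w x) + h x) x = _ := (h1.add (hh x).hasFDerivAt).fderiv
  refine ext_inner_right ℝ fun y => ?_
  rw [inner_gradient_left, h2, inner_add_left, inner_gradient_left, inner_smul_left]
  simp
  ring

/-- The quadratic form `∫ |∇g|² P - 4π²|w|² μ ∫ g² Q`, evaluated at `L(2π⟨w,x⟩) + h`. -/
lemma energy_phase_add (hA : IsUnit A.det) (hw : w ∈ dualLattice (lattice A))
    {L L' P Q Ψ : ℝ → ℝ} (hL : ContDiff ℝ (⊤ : ℕ∞) L) (hLd : ∀ u, HasDerivAt L (L' u) u)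
    (hLp : Function.Periodic L (2 * π)) (hL'c : Continuous L')
    (hψ : ∀ u, HasDerivAt (fun u => L' u * P u) (Ψ u) u) (hΨc : Continuous Ψ)
    (hψp : Function.Periodic (fun u => L' u * P u) (2 * π)) (hP : Continuous P)
    (hQ : Continuous Q) (μ : ℝ) {h : E n → ℝ} (hh : ContDiff ℝ (⊤ : ℕ∞) h)
    (hper : IsPeriodic (lattice A) h) :
    ∫ x, ‖gradient (fun x => L (phase w x) + h x) x‖ ^ 2 * P (phase w x) ∂(cellMeasure A)
      - 4 * π ^ 2 * ‖w‖ ^ 2 * μ *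
        ∫ x, (L (phase w x) + h x) ^ 2 * Q (phase w x) ∂(cellMeasure A)
      = -(4 * π ^ 2 * ‖w‖ ^ 2) * phaseMean A w (fun u => (Ψ u + μ * (L u * Q u)) * L u)
        - 2 * (4 * π ^ 2 * ‖w‖ ^ 2) *
          ∫ x, (Ψ (phase w x) + μ * (L (phase w x) * Q (phase w x))) * h x ∂(cellMeasure A)
        + (∫ x, ‖gradient h x‖ ^ 2 * P (phase w x) ∂(cellMeasure A)
          - 4 * π ^ 2 * ‖w‖ ^ 2 * μ * ∫ x, h x ^ 2 * Q (phase w x) ∂(cellMeasure A)) := by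
  have hLc := hL.continuous
  have hhc := hh.continuous
  have hfc : Continuous fun x => fderiv ℝ h x w :=
    (hh.continuous_fderiv (by simp)).clm_apply continuous_const
  have hgc : Continuous (gradient h) :=
    (InnerProductSpace.toDual ℝ (E n)).symm.continuous.comp (hh.continuous_fderiv (by simp))
  have e1 : ∀ x, ‖gradient (fun x => L (phase w x) + h x) x‖ ^ 2 * P (phase w x)
      = 4 * π ^ 2 * ‖w‖ ^ 2 * (L' (phase w x) * P (phase w x) * L' (phase w x))
        + 4 * π * (L' (phase w x) * P (phase w x) * fderiv ℝ h x w)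
        + ‖gradient h x‖ ^ 2 * P (phase w x) := by
    intro x
    rw [gradient_phase_add hLd (hh.differentiable (by simp)), norm_add_sq_real, norm_smul,
      inner_smul_left, real_inner_comm, inner_gradient_left, mul_pow, Real.norm_eq_abs, sq_abs]
    simp
    ring
  have e2 : ∀ x, (L (phase w x) + h x) ^ 2 * Q (phase w x)
      = L (phase w x) * Q (phase w x) * L (phase w x)
        + 2 * (L (phase w x) * Q (phase w x) * h x) + h x ^ 2 * Q (phase w x) := by
    intro x; ring
  have hLL := integral_comp_phase_mul_fderiv hA hw hψ hΨc hψp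
    (hL.comp contDiff_phase) (isPeriodic_comp_phase hw hLp)
  have hLh := integral_comp_phase_mul_fderiv hA hw hψ hΨc hψp hh hper
  have e3 : ∀ x, fderiv ℝ (L ∘ phase w) x w = 2 * π * ‖w‖ ^ 2 * L' (phase w x) := by
    intro x
    rw [((hLd _).comp_hasFDerivAt x (hasFDerivAt_phase x)).fderiv]
    simp
    ring
  have e4 : ∫ x, L' (phase w x) * P (phase w x) * fderiv ℝ (L ∘ phase w) x w ∂(cellMeasure A)
      = 2 * π * ‖w‖ ^ 2 *
        ∫ x, L' (phase w x) * P (phase w x) * L' (phase w x) ∂(cellMeasure A) := by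
    rw [← integral_const_mul]
    refine integral_congr_ae (Eventually.of_forall fun x => ?_)
    simp only [e3]
    ring
  rw [e4] at hLL
  simp only [e1, e2, phaseMean, add_mul, mul_assoc μ]
  simp only [Function.comp] at hLL
  rw [integral_add (integrable_cellMeasure (by fun_prop)) (integrable_cellMeasure (by fun_prop)),
    integral_add (integrable_cellMeasure (by fun_prop)) (integrable_cellMeasure (by fun_prop)),
    integral_add (integrable_cellMeasure (by fun_prop)) (integrable_cellMeasure (by fun_prop)),
    integral_add (integrable_cellMeasure (by fun_prop)) (integrable_cellMeasure (by fun_prop)),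
    integral_add (integrable_cellMeasure (by fun_prop)) (integrable_cellMeasure (by fun_prop)),
    integral_add (integrable_cellMeasure (by fun_prop)) (integrable_cellMeasure (by fun_prop))]
  simp only [integral_const_mul]
  rw [hLh]
  linear_combination (2 * π) * hLL

end Phase

section Trial

/-- First-order corrected combination of `sin` and `cos`, approximating the low eigenfunctions of
the weighted problem with weights `exp (β τ sin u)` and `exp (α τ sin u)`. -/
def trial (α ε τ x y u : ℝ) : ℝ :=
  x * (sin u + τ * (ε * (1 - 2 * sin u ^ 2) - α / 2)) + y * (cos u - 2 * τ * ε * sin u * cos u)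

/-- The derivative of `trial`. -/
def trialDeriv (ε τ x y u : ℝ) : ℝ :=
  x * (cos u - 4 * τ * ε * sin u * cos u) + y * (-sin u - 2 * τ * ε * (1 - 2 * sin u ^ 2))

/-- The function `L'' + β τ cos u L'` for `L` the function `trial`. -/
def trialOp (β ε τ x y u : ℝ) : ℝ :=
  x * (-sin u + τ * (-4 * ε * (1 - 2 * sin u ^ 2) + β * cos u ^ 2)
      - 4 * β * ε * τ ^ 2 * sin u * cos u ^ 2)
    + y * (-cos u + τ * (8 * ε - β) * sin u * cos u
      - 2 * β * ε * τ ^ 2 * cos u * (1 - 2 * sin u ^ 2))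

/-- The residual of `trial` in the weighted eigenvalue equation with eigenvalue `1 - κ τ²`. -/
def trialResidual (α β ε κ τ x y u : ℝ) : ℝ :=
  trialOp β ε τ x y u * exp (β * τ * sin u)
    + (1 - κ * τ ^ 2) * (trial α ε τ x y u * exp (α * τ * sin u))

/-- The coefficient of `τ²` in the expansion of `trialResidual`. -/
def leadingResidual (α β ε κ x y u : ℝ) : ℝ :=
  x * ((-8 * β * ε + β ^ 2 - κ + α * ε - α ^ 2 / 2) * sin u
      + (12 * β * ε - 3 * β ^ 2 / 2 - 2 * α * ε + α ^ 2 / 2) * sin u ^ 3)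
    + y * ((-2 * β * ε - κ) * cos u
      + (12 * β * ε - 3 * β ^ 2 / 2 - 2 * α * ε + α ^ 2 / 2) * (sin u ^ 2 * cos u))

lemma contDiff_trial (α ε τ x y : ℝ) : ContDiff ℝ (⊤ : ℕ∞) (trial α ε τ x y) := by
  unfold trial; fun_prop

lemma hasDerivAt_trial (α ε τ x y u : ℝ) :
    HasDerivAt (trial α ε τ x y) (trialDeriv ε τ x y u) u := by
  have hs := Real.hasDerivAt_sin u
  have hc := Real.hasDerivAt_cos u
  convert! (((hs.add ((((((hs.pow 2).const_mul 2).const_sub 1).const_mul ε).sub_const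
    (α / 2)).const_mul τ)).const_mul x).add
    ((hc.sub ((hs.mul hc).const_mul (2 * τ * ε))).const_mul y)) using 1
  · ext v; simp only [trial, Pi.add_apply, Pi.sub_apply, Pi.mul_apply, Pi.pow_apply]; ring
  · simp only [trialDeriv]
    push_cast
    linear_combination (2 * τ * ε * y) * Real.sin_sq_add_cos_sq u

lemma hasDerivAt_trialDeriv_mul_exp (β ε τ x y u : ℝ) :
    HasDerivAt (fun u => trialDeriv ε τ x y u * exp (β * τ * sin u))
      (trialOp β ε τ x y u * exp (β * τ * sin u)) u := by
  have hs := Real.hasDerivAt_sin u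
  have hc := Real.hasDerivAt_cos u
  have h1 : HasDerivAt (trialDeriv ε τ x y) (x * (-sin u - 4 * τ * ε * (cos u * cos u
      + sin u * (-sin u))) + y * (-cos u - 2 * τ * ε * (-(2 * (2 * sin u * cos u))))) u := by
    convert! ((hc.sub ((hs.mul hc).const_mul (4 * τ * ε))).const_mul x).add
      ((hs.neg.sub ((((hs.pow 2).const_mul 2).const_sub 1).const_mul (2 * τ * ε))).const_mul y)
      using 1
    · ext v
      simp only [trialDeriv, Pi.neg_apply, Pi.sub_apply, Pi.add_apply, Pi.mul_apply, Pi.pow_apply]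
      ring
    · push_cast; ring
  convert! h1.mul (hs.const_mul (β * τ)).exp using 1
  simp only [trialOp, trialDeriv]
  linear_combination (4 * τ * ε * x * exp (β * τ * sin u)) * Real.sin_sq_add_cos_sq u

lemma periodic_trial (α ε τ x y : ℝ) : Function.Periodic (trial α ε τ x y) (2 * π) := fun u => by
  simp [trial]

lemma periodic_trialDeriv_mul_exp (β ε τ x y : ℝ) :
    Function.Periodic (fun u => trialDeriv ε τ x y u * exp (β * τ * sin u)) (2 * π) := fun u => by
  simp [trialDeriv]

@[fun_prop]
lemma continuous_trial (α ε τ x y : ℝ) : Continuous (trial α ε τ x y) :=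
  (contDiff_trial α ε τ x y).continuous

@[fun_prop]
lemma continuous_trialDeriv (ε τ x y : ℝ) : Continuous (trialDeriv ε τ x y) := by
  unfold trialDeriv; fun_prop

@[fun_prop]
lemma continuous_trialOp (β ε τ x y : ℝ) : Continuous (trialOp β ε τ x y) := by
  unfold trialOp; fun_prop

@[fun_prop]
lemma continuous_trialResidual (α β ε κ τ x y : ℝ) : Continuous (trialResidual α β ε κ τ x y) := by
  unfold trialResidual; fun_prop

@[fun_prop]
lemma continuous_leadingResidual (α β ε κ x y : ℝ) :
    Continuous (leadingResidual α β ε κ x y) := by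
  unfold leadingResidual; fun_prop

lemma exists_exp_eq_cubic {z : ℝ} (hz : |z| ≤ 1) :
    ∃ ρ : ℝ, |ρ| ≤ 1 ∧ exp z = 1 + z + z ^ 2 / 2 + z ^ 3 * ρ := by
  have h := Real.exp_bound hz (n := 3) (by norm_num)
  norm_num [Finset.sum_range_succ, Nat.factorial] at h
  rcases eq_or_ne z 0 with rfl | h0
  · exact ⟨0, by simp, by simp⟩
  refine ⟨(exp z - (1 + z + z ^ 2 / 2)) / z ^ 3, ?_, by field_simp; ring⟩
  rw [abs_div, abs_pow, div_le_one (by positivity)]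
  have : 0 ≤ |z| ^ 3 := by positivity
  linarith

lemma exists_bound_of_continuous_cube {G : ℝ × ℝ × ℝ × ℝ × ℝ → ℝ} (hG : Continuous G) :
    ∃ K, 0 ≤ K ∧ ∀ a b c d e : ℝ, |a| ≤ 1 → |b| ≤ 1 → |c| ≤ 1 → |d| ≤ 1 → |e| ≤ 1 →
      |G (a, b, c, d, e)| ≤ K := by
  obtain ⟨K, hK⟩ := (isCompact_Icc (a := ((-1, -1, -1, -1, -1) : ℝ × ℝ × ℝ × ℝ × ℝ))
    (b := (1, 1, 1, 1, 1))).exists_bound_of_continuousOn hG.continuousOn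
  refine ⟨|K|, abs_nonneg _, fun a b c d e ha hb hc hd he => ?_⟩
  rw [abs_le] at ha hb hc hd he
  exact (hK (a, b, c, d, e) ⟨⟨ha.1, hb.1, hc.1, hd.1, he.1⟩,
    ⟨ha.2, hb.2, hc.2, hd.2, he.2⟩⟩).trans (le_abs_self K)

lemma exists_residual_bound {α β ε : ℝ} (hε : 3 * ε = β - α / 2) (κ : ℝ) :
    ∃ K, 0 ≤ K ∧ ∀ τ x y u : ℝ, |τ| ≤ 1 → |α * τ| ≤ 1 → |β * τ| ≤ 1 →
      |trialResidual α β ε κ τ x y u - τ ^ 2 * leadingResidual α β ε κ x y u|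
        ≤ K * |τ| ^ 3 * (|x| + |y|) := by
  obtain ⟨G₁, hG₁⟩ : ∃ G : ℝ × ℝ × ℝ × ℝ × ℝ → ℝ, G = fun (τ, s, c, ρ, σ) =>
      β ^ 3 * s ^ 3 * ρ * (-s + τ * (-4 * ε * (1 - 2 * s ^ 2) + β * c ^ 2)
        - 4 * β * ε * τ ^ 2 * s * c ^ 2)
      + β ^ 2 * s ^ 2 / 2 * ((-4 * ε * (1 - 2 * s ^ 2) + β * c ^ 2)
        - 4 * β * ε * τ * s * c ^ 2) + β * s * (-4 * β * ε * s * c ^ 2)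
      + α ^ 3 * s ^ 3 * σ * (s + τ * (ε * (1 - 2 * s ^ 2) - α / 2))
      + α ^ 2 * s ^ 2 / 2 * (ε * (1 - 2 * s ^ 2) - α / 2)
      - κ * ((ε * (1 - 2 * s ^ 2) - α / 2)
        + (α * s + τ * (α ^ 2 * s ^ 2 / 2) + τ ^ 2 * (α ^ 3 * s ^ 3 * σ))
          * (s + τ * (ε * (1 - 2 * s ^ 2) - α / 2))) := ⟨_, rfl⟩
  obtain ⟨G₂, hG₂⟩ : ∃ G : ℝ × ℝ × ℝ × ℝ × ℝ → ℝ, G = fun (τ, s, c, ρ, σ) =>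
      β ^ 3 * s ^ 3 * ρ * (-c + τ * (8 * ε - β) * s * c
        - 2 * β * ε * τ ^ 2 * c * (1 - 2 * s ^ 2))
      + β ^ 2 * s ^ 2 / 2 * ((8 * ε - β) * s * c
        - 2 * β * ε * τ * c * (1 - 2 * s ^ 2)) + β * s * (-2 * β * ε * c * (1 - 2 * s ^ 2))
      + α ^ 3 * s ^ 3 * σ * (c - 2 * τ * ε * s * c)
      + α ^ 2 * s ^ 2 / 2 * (-2 * ε * s * c)
      - κ * (-2 * ε * s * c
        + (α * s + τ * (α ^ 2 * s ^ 2 / 2) + τ ^ 2 * (α ^ 3 * s ^ 3 * σ))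
          * (c - 2 * τ * ε * s * c)) := ⟨_, rfl⟩
  obtain ⟨K₁, hK₁, h₁⟩ := exists_bound_of_continuous_cube (G := G₁) (by rw [hG₁]; fun_prop)
  obtain ⟨K₂, hK₂, h₂⟩ := exists_bound_of_continuous_cube (G := G₂) (by rw [hG₂]; fun_prop)
  refine ⟨K₁ + K₂, by positivity, fun τ x y u hτ hα hβ => ?_⟩
  have hs := Real.abs_sin_le_one u
  have hc := Real.abs_cos_le_one u
  have small : ∀ r : ℝ, |r * τ| ≤ 1 → |r * τ * sin u| ≤ 1 := fun r hr => by
    rw [abs_mul]; exact mul_le_one₀ hr (abs_nonneg _) hs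
  obtain ⟨ρ, hρ, eρ⟩ := exists_exp_eq_cubic (small β hβ)
  obtain ⟨σ, hσ, eσ⟩ := exists_exp_eq_cubic (small α hα)
  have b₁ := h₁ τ (sin u) (cos u) ρ σ hτ hs hc hρ hσ
  have b₂ := h₂ τ (sin u) (cos u) ρ σ hτ hs hc hρ hσ
  have key : trialResidual α β ε κ τ x y u - τ ^ 2 * leadingResidual α β ε κ x y u
      = τ ^ 3 * (x * G₁ (τ, sin u, cos u, ρ, σ) + y * G₂ (τ, sin u, cos u, ρ, σ)) := by
    simp only [hG₁, hG₂, trialResidual, leadingResidual, trialOp, trial, eρ, eσ]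
    linear_combination (x * τ * β + τ ^ 2 * x * (β ^ 2 - 4 * β * ε) * sin u)
        * Real.sin_sq_add_cos_sq u
      + (-x * τ * (1 - 2 * sin u ^ 2) + 2 * y * τ * sin u * cos u) * hε
  rw [key, abs_mul, abs_pow]
  calc |τ| ^ 3 * |x * G₁ (τ, sin u, cos u, ρ, σ) + y * G₂ (τ, sin u, cos u, ρ, σ)|
      ≤ |τ| ^ 3 * (|x| * K₁ + |y| * K₂) := by
        gcongr
        refine (abs_add_le _ _).trans ?_
        rw [abs_mul, abs_mul]
        gcongr
    _ ≤ (K₁ + K₂) * |τ| ^ 3 * (|x| + |y|) := by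
        have : 0 ≤ |τ| ^ 3 * (|x| * K₂ + |y| * K₁) := by positivity
        linarith

lemma exists_trial_bound (α ε : ℝ) :
    ∃ K, 0 ≤ K ∧ ∀ τ x y u : ℝ,
      |trial α ε τ x y u - (x * sin u + y * cos u)| ≤ K * |τ| * (|x| + |y|) := by
  refine ⟨3 * |ε| + |α|, by positivity, fun τ x y u => ?_⟩
  have hs := Real.abs_sin_le_one u
  have hc := Real.abs_cos_le_one u
  have h1 : |ε * (1 - 2 * sin u ^ 2) - α / 2| ≤ 3 * |ε| + |α| := by
    have h : |1 - 2 * sin u ^ 2| ≤ 3 := by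
      rw [abs_le]; constructor <;> nlinarith [Real.sin_sq_le_one u, sq_nonneg (sin u)]
    calc |ε * (1 - 2 * sin u ^ 2) - α / 2| ≤ |ε| * |1 - 2 * sin u ^ 2| + |α / 2| := by
          rw [← abs_mul]; exact abs_sub _ _
      _ ≤ |ε| * 3 + |α| := by
          have h' : |α / 2| ≤ |α| := by rw [abs_div, abs_two]; linarith [abs_nonneg α]
          gcongr
      _ = _ := by ring
  have h2 : |-2 * ε * (sin u * cos u)| ≤ 3 * |ε| + |α| := by
    have h : |sin u| * |cos u| ≤ 1 := mul_le_one₀ hs (abs_nonneg _) hc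
    rw [abs_mul, abs_mul, abs_mul, abs_neg, abs_two]
    nlinarith [abs_nonneg ε, abs_nonneg α]
  have e : trial α ε τ x y u - (x * sin u + y * cos u)
      = τ * (x * (ε * (1 - 2 * sin u ^ 2) - α / 2) + y * (-2 * ε * (sin u * cos u))) := by
    simp only [trial]; ring
  rw [e, abs_mul]
  calc |τ| * |x * (ε * (1 - 2 * sin u ^ 2) - α / 2) + y * (-2 * ε * (sin u * cos u))|
      ≤ |τ| * (|x| * (3 * |ε| + |α|) + |y| * (3 * |ε| + |α|)) := by
        gcongr
        refine (abs_add_le _ _).trans ?_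
        rw [abs_mul, abs_mul]
        gcongr
    _ = _ := by ring

lemma exists_leadingResidual_bound (α β ε κ : ℝ) :
    ∃ K, 0 ≤ K ∧ ∀ x y u : ℝ, |leadingResidual α β ε κ x y u| ≤ K * (|x| + |y|) := by
  obtain ⟨G₁, hG₁⟩ : ∃ G : ℝ × ℝ × ℝ × ℝ × ℝ → ℝ, G = fun (_, s, _, _, _) =>
      (-8 * β * ε + β ^ 2 - κ + α * ε - α ^ 2 / 2) * s
      + (12 * β * ε - 3 * β ^ 2 / 2 - 2 * α * ε + α ^ 2 / 2) * s ^ 3 := ⟨_, rfl⟩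
  obtain ⟨G₂, hG₂⟩ : ∃ G : ℝ × ℝ × ℝ × ℝ × ℝ → ℝ, G = fun (_, s, c, _, _) =>
      (-2 * β * ε - κ) * c
      + (12 * β * ε - 3 * β ^ 2 / 2 - 2 * α * ε + α ^ 2 / 2) * (s ^ 2 * c) := ⟨_, rfl⟩
  obtain ⟨K₁, hK₁, h₁⟩ := exists_bound_of_continuous_cube (G := G₁) (by rw [hG₁]; fun_prop)
  obtain ⟨K₂, hK₂, h₂⟩ := exists_bound_of_continuous_cube (G := G₂) (by rw [hG₂]; fun_prop)
  refine ⟨K₁ + K₂, by positivity, fun x y u => ?_⟩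
  have hs := Real.abs_sin_le_one u
  have hc := Real.abs_cos_le_one u
  have b₁ := h₁ 0 (sin u) (cos u) 0 0 (by simp) hs hc (by simp) (by simp)
  have b₂ := h₂ 0 (sin u) (cos u) 0 0 (by simp) hs hc (by simp) (by simp)
  have e : leadingResidual α β ε κ x y u
      = x * G₁ (0, sin u, cos u, 0, 0) + y * G₂ (0, sin u, cos u, 0, 0) := by
    simp only [hG₁, hG₂, leadingResidual]
  rw [e]
  refine (abs_add_le _ _).trans ?_
  rw [abs_mul, abs_mul]
  nlinarith [mul_le_mul_of_nonneg_left b₁ (abs_nonneg x),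
    mul_le_mul_of_nonneg_left b₂ (abs_nonneg y), mul_nonneg (abs_nonneg x) hK₂,
    mul_nonneg (abs_nonneg y) hK₁]

/-- Pointwise bounds for the residual: it is `O(τ²)`, and its product with the trial function is
known up to `O(τ³)`. -/
lemma exists_residual_mul_trial_le {α β ε : ℝ} (hε : 3 * ε = β - α / 2) (κ : ℝ) :
    ∃ K, 0 ≤ K ∧ ∀ τ x y u : ℝ, |τ| ≤ 1 → |α * τ| ≤ 1 → |β * τ| ≤ 1 →
      trialResidual α β ε κ τ x y u * trial α ε τ x y u
        ≤ τ ^ 2 * (leadingResidual α β ε κ x y u * (x * sin u + y * cos u))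
          + K * |τ| ^ 3 * (x ^ 2 + y ^ 2) ∧
      trialResidual α β ε κ τ x y u ^ 2 ≤ K * |τ| ^ 4 * (x ^ 2 + y ^ 2) := by
  obtain ⟨K₁, hK₁, h₁⟩ := exists_residual_bound hε κ
  obtain ⟨K₂, hK₂, h₂⟩ := exists_trial_bound α ε
  obtain ⟨K₃, hK₃, h₃⟩ := exists_leadingResidual_bound α β ε κ
  refine ⟨2 * (K₁ * (K₂ + 1) + K₃ * K₂) + 2 * (K₁ + K₃) ^ 2, by positivity,
    fun τ x y u hτ hα hβ => ?_⟩
  have b₁ := h₁ τ x y u hτ hα hβ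
  have b₂ := h₂ τ x y u
  have b₃ := h₃ x y u
  set R := trialResidual α β ε κ τ x y u
  set M := leadingResidual α β ε κ x y u
  set L := trial α ε τ x y u
  set r := |x| + |y| with hr
  have hr0 : 0 ≤ r := by positivity
  have hr2 : r ^ 2 ≤ 2 * (x ^ 2 + y ^ 2) := by
    rw [hr, ← sq_abs x, ← sq_abs y]; nlinarith [sq_nonneg (|x| - |y|)]
  have hτ0 := abs_nonneg τ
  have hL0 : |x * sin u + y * cos u| ≤ r := by
    refine (abs_add_le _ _).trans ?_
    rw [abs_mul, abs_mul]
    nlinarith [mul_le_mul_of_nonneg_left (Real.abs_sin_le_one u) (abs_nonneg x),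
      mul_le_mul_of_nonneg_left (Real.abs_cos_le_one u) (abs_nonneg y)]
  have hL : |L| ≤ (K₂ + 1) * r := by
    have h := abs_add_le (L - (x * sin u + y * cos u)) (x * sin u + y * cos u)
    rw [sub_add_cancel] at h
    nlinarith [mul_le_mul_of_nonneg_left hτ (mul_nonneg hK₂ hr0)]
  constructor
  · have e : R * L = τ ^ 2 * (M * (x * sin u + y * cos u)) + ((R - τ ^ 2 * M) * L
        + τ ^ 2 * (M * (L - (x * sin u + y * cos u)))) := by ring
    have t1 : (R - τ ^ 2 * M) * L ≤ (K₁ * |τ| ^ 3 * r) * ((K₂ + 1) * r) := by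
      refine (le_abs_self _).trans ?_
      rw [abs_mul]
      gcongr
    have t2 : τ ^ 2 * (M * (L - (x * sin u + y * cos u)))
        ≤ |τ| ^ 2 * ((K₃ * r) * (K₂ * |τ| * r)) := by
      refine (le_abs_self _).trans ?_
      rw [abs_mul, abs_mul, abs_pow]
      gcongr
    have t3 : (K₁ * |τ| ^ 3 * r) * ((K₂ + 1) * r) + |τ| ^ 2 * ((K₃ * r) * (K₂ * |τ| * r))
        ≤ (K₁ * (K₂ + 1) + K₃ * K₂) * |τ| ^ 3 * (2 * (x ^ 2 + y ^ 2)) := by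
      calc _ = (K₁ * (K₂ + 1) + K₃ * K₂) * |τ| ^ 3 * r ^ 2 := by ring
        _ ≤ _ := by gcongr
    have t4 : 0 ≤ 2 * (K₁ + K₃) ^ 2 * |τ| ^ 3 * (x ^ 2 + y ^ 2) := by positivity
    rw [e]
    linarith
  · have hR : |R| ≤ |τ| ^ 2 * ((K₁ + K₃) * r) := by
      have h := abs_add_le (R - τ ^ 2 * M) (τ ^ 2 * M)
      rw [sub_add_cancel, abs_mul, abs_pow] at h
      have t1 : |τ| ^ 2 * |M| ≤ |τ| ^ 2 * (K₃ * r) := by gcongr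
      have t2 : K₁ * |τ| ^ 3 * r ≤ |τ| ^ 2 * (K₁ * r) := by
        calc K₁ * |τ| ^ 3 * r = |τ| ^ 2 * (K₁ * r) * |τ| := by ring
          _ ≤ |τ| ^ 2 * (K₁ * r) * 1 := by gcongr
          _ = _ := mul_one _
      linarith
    calc R ^ 2 = |R| ^ 2 := (sq_abs R).symm
      _ ≤ (|τ| ^ 2 * ((K₁ + K₃) * r)) ^ 2 := by gcongr
      _ = (K₁ + K₃) ^ 2 * |τ| ^ 4 * r ^ 2 := by ring
      _ ≤ (K₁ + K₃) ^ 2 * |τ| ^ 4 * (2 * (x ^ 2 + y ^ 2)) := by gcongr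
      _ ≤ _ := by
        have : 0 ≤ 2 * (K₁ * (K₂ + 1) + K₃ * K₂) * |τ| ^ 4 * (x ^ 2 + y ^ 2) := by positivity
        linarith

end Trial

section Perturbation

variable {n : ℕ} {A : Matrix (Fin n) (Fin n) ℝ} {w : E n}

lemma phaseMean_leadingResidual (hA : IsUnit A.det) (hw : w ∈ dualLattice (lattice A))
    (hw0 : w ≠ 0) (α β ε κ x y : ℝ) :
    phaseMean A w (fun u => leadingResidual α β ε κ x y u * (x * sin u + y * cos u))
      = x ^ 2 * ((-8 * β * ε + β ^ 2 - κ + α * ε - α ^ 2 / 2) / 2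
          + 3 * (12 * β * ε - 3 * β ^ 2 / 2 - 2 * α * ε + α ^ 2 / 2) / 8)
        + y ^ 2 * ((-2 * β * ε - κ) / 2
          + (12 * β * ε - 3 * β ^ 2 / 2 - 2 * α * ε + α ^ 2 / 2) / 8) := by
  set a := -8 * β * ε + β ^ 2 - κ + α * ε - α ^ 2 / 2 with ha
  set b := 12 * β * ε - 3 * β ^ 2 / 2 - 2 * α * ε + α ^ 2 / 2 with hb
  set c := -2 * β * ε - κ with hc
  have e : (fun u => leadingResidual α β ε κ x y u * (x * sin u + y * cos u))
      = fun u => ((((x ^ 2 * a) * sin u ^ 2 + (x ^ 2 * b) * sin u ^ 4)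
        + (x * y * (a + c)) * (sin u * cos u)) + (2 * x * y * b) * (sin u ^ 3 * cos u))
        + (y ^ 2 * c) * cos u ^ 2 + (y ^ 2 * b) * (sin u ^ 2 * cos u ^ 2) := by
    ext u; simp only [leadingResidual]; ring
  rw [e]
  repeat rw [phaseMean_add (by fun_prop) (by fun_prop)]
  simp only [phaseMean_const_mul]
  rw [phaseMean_sin_sq hA hw hw0, phaseMean_sin_pow_four hA hw hw0,
    phaseMean_sin_mul_cos hA hw hw0, phaseMean_sin_cube_mul_cos hA hw hw0,
    phaseMean_cos_sq hA hw hw0, phaseMean_sin_sq_mul_cos_sq hA hw hw0]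
  ring

lemma phaseMean_trial_mul_sin (hA : IsUnit A.det) (hw : w ∈ dualLattice (lattice A))
    (hw0 : w ≠ 0) (α ε τ x y : ℝ) :
    phaseMean A w (fun u => trial α ε τ x y u * sin u) = x / 2 := by
  have e : (fun u => trial α ε τ x y u * sin u)
      = fun u => x * sin u ^ 2 + (x * τ * (ε - α / 2)) * sin u + (-2 * x * τ * ε) * sin u ^ 3
        + y * (sin u * cos u) + (-2 * τ * ε * y) * (sin u ^ 2 * cos u) := by
    ext u; simp only [trial]; ring
  rw [e]
  repeat rw [phaseMean_add (by fun_prop) (by fun_prop)]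
  simp only [phaseMean_const_mul]
  rw [phaseMean_sin_sq hA hw hw0, phaseMean_sin hA hw hw0, phaseMean_sin_cube hA hw hw0,
    phaseMean_sin_mul_cos hA hw hw0, phaseMean_sin_sq_mul_cos hA hw hw0]
  ring

lemma phaseMean_trial_mul_cos (hA : IsUnit A.det) (hw : w ∈ dualLattice (lattice A))
    (hw0 : w ≠ 0) (α ε τ x y : ℝ) :
    phaseMean A w (fun u => trial α ε τ x y u * cos u) = y / 2 := by
  have e : (fun u => trial α ε τ x y u * cos u)
      = fun u => x * (sin u * cos u) + (x * τ * (ε - α / 2)) * cos u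
        + (-2 * x * τ * ε) * (sin u ^ 2 * cos u)
        + y * cos u ^ 2 + (-2 * τ * ε * y) * (sin u * cos u ^ 2) := by
    ext u; simp only [trial]; ring
  rw [e]
  repeat rw [phaseMean_add (by fun_prop) (by fun_prop)]
  simp only [phaseMean_const_mul]
  rw [phaseMean_cos_sq hA hw hw0, phaseMean_cos hA hw hw0, phaseMean_sin_mul_cos_sq hA hw hw0,
    phaseMean_sin_mul_cos hA hw hw0, phaseMean_sin_sq_mul_cos hA hw hw0]
  ring

/-- Every smooth periodic function is a constant plus a trial function of the phase plus a
remainder orthogonal to `1`, `sin` and `cos` of the phase. -/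
lemma exists_trial_decomposition (hA : IsUnit A.det) (hw : w ∈ dualLattice (lattice A))
    (hw0 : w ≠ 0) (α ε τ : ℝ) {f : E n → ℝ} (hf : ContDiff ℝ (⊤ : ℕ∞) f)
    (hper : IsPeriodic (lattice A) f) :
    ∃ x y m : ℝ, ∃ h : E n → ℝ, ContDiff ℝ (⊤ : ℕ∞) h ∧ IsPeriodic (lattice A) h ∧
      (∀ z, f z = trial α ε τ x y (phase w z) + h z + m) ∧
      ∫ z, h z ∂(cellMeasure A) = 0 ∧
      ∫ z, h z * sin (phase w z) ∂(cellMeasure A) = 0 ∧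
      ∫ z, h z * cos (phase w z) ∂(cellMeasure A) = 0 := by
  set x := 2 * ∫ z, f z * sin (phase w z) ∂(cellMeasure A) with hx
  set y := 2 * ∫ z, f z * cos (phase w z) ∂(cellMeasure A) with hy
  set m := ∫ z, f z ∂(cellMeasure A) - phaseMean A w (trial α ε τ x y) with hm
  have hfc := hf.continuous
  have orth : ∀ ψ : ℝ → ℝ, Continuous ψ →
      ∫ z, (f z - trial α ε τ x y (phase w z) - m) * ψ (phase w z) ∂(cellMeasure A)
        = ∫ z, f z * ψ (phase w z) ∂(cellMeasure A)
          - phaseMean A w (fun u => trial α ε τ x y u * ψ u) - m * phaseMean A w ψ := by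
    intro ψ hψ
    simp only [sub_mul, phaseMean]
    rw [integral_sub (integrable_cellMeasure (by fun_prop)) (integrable_cellMeasure (by fun_prop)),
      integral_sub (integrable_cellMeasure (by fun_prop)) (integrable_cellMeasure (by fun_prop)),
      integral_const_mul]
  refine ⟨x, y, m, fun z => f z - trial α ε τ x y (phase w z) - m,
    (hf.sub ((contDiff_trial α ε τ x y).comp contDiff_phase)).sub contDiff_const,
    fun z γ hγ => ?_, fun z => by ring, ?_, ?_, ?_⟩
  · have h1 : trial α ε τ x y (phase w (z + γ)) = trial α ε τ x y (phase w z) :=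
      isPeriodic_comp_phase hw (periodic_trial α ε τ x y) z γ hγ
    simp only [h1, hper z γ hγ]
  · have h := orth (fun _ => 1) continuous_const
    simp only [mul_one, phaseMean_const] at h
    rw [h]
    simp [hm]
  · rw [orth _ Real.continuous_sin, phaseMean_trial_mul_sin hA hw hw0, phaseMean_sin hA hw hw0, hx]
    ring
  · rw [orth _ Real.continuous_cos, phaseMean_trial_mul_cos hA hw hw0, phaseMean_cos hA hw hw0, hy]
    ring

lemma exp_mul_sin_le (r u : ℝ) : exp (r * sin u) ≤ exp |r| := by
  refine exp_le_exp.mpr ((le_abs_self _).trans ?_)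
  rw [abs_mul]
  exact mul_le_of_le_one_right (abs_nonneg _) (Real.abs_sin_le_one u)

lemma exp_neg_abs_le (r u : ℝ) : exp (-|r|) ≤ exp (r * sin u) := by
  refine exp_le_exp.mpr ((neg_le_neg ?_).trans (neg_abs_le _))
  rw [abs_mul]
  exact mul_le_of_le_one_right (abs_nonneg _) (Real.abs_sin_le_one u)

/-- Weighted spectral gap on the orthogonal complement of the low modes. -/
lemma weighted_poincare_of_orthogonal (hA : IsUnit A.det) {Λ : ℝ}
    (hΛ : ∀ m, dualVec A m ≠ 0 → dualVec A m ≠ w → dualVec A m ≠ -w → Λ ≤ ‖dualVec A m‖ ^ 2)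
    (a b : ℝ) {μ : ℝ} (hμ1 : μ ≤ 1)
    {h : E n → ℝ} (hh : ContDiff ℝ (⊤ : ℕ∞) h) (hper : IsPeriodic (lattice A) h)
    (h0 : ∫ z, h z ∂(cellMeasure A) = 0)
    (hs : ∫ z, h z * sin (phase w z) ∂(cellMeasure A) = 0)
    (hc : ∫ z, h z * cos (phase w z) ∂(cellMeasure A) = 0) :
    4 * π ^ 2 * (Λ * exp (-|b|) - ‖w‖ ^ 2 * exp |a|) * ∫ z, h z ^ 2 ∂(cellMeasure A)
      ≤ ∫ z, ‖gradient h z‖ ^ 2 * exp (b * sin (phase w z)) ∂(cellMeasure A)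
        - 4 * π ^ 2 * ‖w‖ ^ 2 * μ *
          ∫ z, h z ^ 2 * exp (a * sin (phase w z)) ∂(cellMeasure A) := by
  have hhc := hh.continuous
  have hgc : Continuous (gradient h) :=
    (InnerProductSpace.toDual ℝ (E n)).symm.continuous.comp (hh.continuous_fderiv (by simp))
  have hp := poincare_of_orthogonal hA hΛ hh hper h0 hs hc
  have h1 : exp (-|b|) * ∫ z, ‖gradient h z‖ ^ 2 ∂(cellMeasure A)
      ≤ ∫ z, ‖gradient h z‖ ^ 2 * exp (b * sin (phase w z)) ∂(cellMeasure A) := by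
    rw [← integral_const_mul]
    refine integral_mono (integrable_cellMeasure (by fun_prop))
      (integrable_cellMeasure (by fun_prop)) fun z => ?_
    dsimp only
    rw [mul_comm]
    exact mul_le_mul_of_nonneg_left (exp_neg_abs_le _ _) (sq_nonneg _)
  have h2 : ∫ z, h z ^ 2 * exp (a * sin (phase w z)) ∂(cellMeasure A)
      ≤ exp |a| * ∫ z, h z ^ 2 ∂(cellMeasure A) := by
    rw [← integral_const_mul]
    refine integral_mono (integrable_cellMeasure (by fun_prop))
      (integrable_cellMeasure (by fun_prop)) fun z => ?_
    dsimp only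
    rw [mul_comm (exp |a|)]
    exact mul_le_mul_of_nonneg_left (exp_mul_sin_le _ _) (sq_nonneg _)
  have h3 : 0 ≤ ∫ z, h z ^ 2 * exp (a * sin (phase w z)) ∂(cellMeasure A) :=
    integral_nonneg fun z => by positivity
  have h4 := mul_le_mul_of_nonneg_left hp (exp_pos (-|b|)).le
  have h5 : 4 * π ^ 2 * ‖w‖ ^ 2 * μ * ∫ z, h z ^ 2 * exp (a * sin (phase w z)) ∂(cellMeasure A)
      ≤ 4 * π ^ 2 * ‖w‖ ^ 2 * (exp |a| * ∫ z, h z ^ 2 ∂(cellMeasure A)) := by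
    calc _ ≤ 4 * π ^ 2 * ‖w‖ ^ 2 * 1 *
          ∫ z, h z ^ 2 * exp (a * sin (phase w z)) ∂(cellMeasure A) := by gcongr
      _ ≤ _ := by rw [mul_one]; gcongr
  linarith

/-- The variance is the minimal mean square deviation from a constant, for a weighted mean. -/
lemma integral_sq_mul_le (f : E n → ℝ) (hf : Continuous f) {Q : E n → ℝ} (hQ : Continuous Q)
    (hQ0 : ∀ z, 0 ≤ Q z) (h0 : ∫ z, f z * Q z ∂(cellMeasure A) = 0) (m : ℝ) :
    ∫ z, f z ^ 2 * Q z ∂(cellMeasure A) ≤ ∫ z, (f z - m) ^ 2 * Q z ∂(cellMeasure A) := by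
  have e : ∀ z, (f z - m) ^ 2 * Q z = f z ^ 2 * Q z + (-2 * m) * (f z * Q z) + m ^ 2 * Q z :=
    fun z => by ring
  simp only [e]
  rw [integral_add (integrable_cellMeasure (by fun_prop)) (integrable_cellMeasure (by fun_prop)),
    integral_add (integrable_cellMeasure (by fun_prop)) (integrable_cellMeasure (by fun_prop)),
    integral_const_mul, integral_const_mul, h0]
  have : 0 ≤ ∫ z, Q z ∂(cellMeasure A) := integral_nonneg hQ0
  nlinarith [mul_nonneg (sq_nonneg m) this]

end Perturbation

section Perturbation

variable {n : ℕ} {A : Matrix (Fin n) (Fin n) ℝ} {w : E n}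

/-- Second-order lower bound for the first eigenvalue of the weighted problem. -/
lemma eventually_weighted_eigenvalue_bound (hA : IsUnit A.det)
    (hgap : GapCondition (lattice A) w) {α β ε κ q : ℝ} (hε : 3 * ε = β - α / 2) (hκ : 0 ≤ κ)
    (hq : 0 < q)
    (hqx : (-8 * β * ε + β ^ 2 - κ + α * ε - α ^ 2 / 2) / 2
      + 3 * (12 * β * ε - 3 * β ^ 2 / 2 - 2 * α * ε + α ^ 2 / 2) / 8 ≤ -q)
    (hqy : (-2 * β * ε - κ) / 2
      + (12 * β * ε - 3 * β ^ 2 / 2 - 2 * α * ε + α ^ 2 / 2) / 8 ≤ -q) :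
    ∀ᶠ τ in 𝓝 (0 : ℝ), ∀ f : E n → ℝ, ContDiff ℝ (⊤ : ℕ∞) f → IsPeriodic (lattice A) f →
      ∫ z, f z * exp (α * τ * sin (phase w z)) ∂(cellMeasure A) = 0 →
      4 * π ^ 2 * ‖w‖ ^ 2 * (1 - κ * τ ^ 2) *
          ∫ z, f z ^ 2 * exp (α * τ * sin (phase w z)) ∂(cellMeasure A)
        ≤ ∫ z, ‖gradient f z‖ ^ 2 * exp (β * τ * sin (phase w z)) ∂(cellMeasure A) := by
  obtain ⟨Λ, hΛw, hΛ⟩ := exists_spectral_gap hA hgap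
  obtain ⟨hw, hw0, -⟩ := hgap
  obtain ⟨K, hK, hR⟩ := exists_residual_mul_trial_le hε κ
  obtain ⟨ρ, hρ⟩ : ∃ ρ, ρ = (Λ - ‖w‖ ^ 2) / 2 := ⟨_, rfl⟩
  have hρ0 : 0 < ρ := by rw [hρ]; linarith
  have ev : ∀ F : ℝ → ℝ, Continuous F → 0 < F 0 → ∀ᶠ τ in 𝓝 0, 0 < F τ := fun F hF h =>
    hF.continuousAt.eventually (lt_mem_nhds h)
  filter_upwards [ev (fun τ => 1 - |τ|) (by fun_prop) (by simp),
    ev (fun τ => 1 - |α * τ|) (by fun_prop) (by simp),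
    ev (fun τ => 1 - |β * τ|) (by fun_prop) (by simp),
    ev (fun τ => 1 - κ * τ ^ 2) (by fun_prop) (by simp),
    ev (fun τ => Λ * exp (-|β * τ|) - ‖w‖ ^ 2 * exp |α * τ| - ρ) (by fun_prop)
      (by simp; linarith),
    ev (fun τ => q - K * |τ| - K * τ ^ 2 * (‖w‖ ^ 2 / ρ)) (by fun_prop) (by simpa using hq)]
    with τ h1 h2 h3 h4 h5 h6 f hf hper hf0
  obtain ⟨x, y, m, h, hh, hhper, hfe, hh0, hhs, hhc⟩ :=
    exists_trial_decomposition hA hw hw0 α ε τ hf hper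
  have hb := fun u => hR τ x y u (by linarith) (by linarith) (by linarith)
  have hhcont := hh.continuous
  have hvar := integral_sq_mul_le (A := A) f hf.continuous
    (Q := fun z => exp (α * τ * sin (phase w z))) (by fun_prop) (fun z => (exp_pos _).le) hf0 m
  have hfm : ∀ z, f z - m = trial α ε τ x y (phase w z) + h z := fun z => by rw [hfe]; ring
  have hgrad : gradient f = gradient fun z => trial α ε τ x y (phase w z) + h z := by
    ext1 z
    rw [funext hfe, gradient, gradient, fderiv_add_const]
  have hen := energy_phase_add (A := A) hA hw (contDiff_trial α ε τ x y)
    (hasDerivAt_trial α ε τ x y) (periodic_trial α ε τ x y) (by fun_prop)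
    (hasDerivAt_trialDeriv_mul_exp β ε τ x y) (by fun_prop)
    (periodic_trialDeriv_mul_exp β ε τ x y) (by fun_prop)
    (Q := fun u => exp (α * τ * sin u)) (by fun_prop) (1 - κ * τ ^ 2) hh hhper
  have hrem := weighted_poincare_of_orthogonal hA hΛ (α * τ) (β * τ) (μ := 1 - κ * τ ^ 2)
    (by nlinarith [sq_nonneg τ]) hh hhper hh0 hhs hhc
  have hH : 0 ≤ ∫ z, h z ^ 2 ∂(cellMeasure A) := integral_nonneg fun z => sq_nonneg _
  have hRL : phaseMean A w (fun u => trialResidual α β ε κ τ x y u * trial α ε τ x y u)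
      ≤ -(q * τ ^ 2 * (x ^ 2 + y ^ 2)) + K * |τ| ^ 3 * (x ^ 2 + y ^ 2) := by
    refine (phaseMean_mono (by fun_prop) (by fun_prop) fun u => (hb u).1).trans ?_
    rw [phaseMean_add (by fun_prop) (by fun_prop), phaseMean_const_mul, phaseMean_const,
      phaseMean_leadingResidual hA hw hw0]
    nlinarith [mul_le_mul_of_nonneg_left hqx (mul_nonneg (sq_nonneg τ) (sq_nonneg x)),
      mul_le_mul_of_nonneg_left hqy (mul_nonneg (sq_nonneg τ) (sq_nonneg y))]
  have hRh : 2 * ‖w‖ ^ 2 * ∫ z, trialResidual α β ε κ τ x y (phase w z) * h z ∂(cellMeasure A)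
      ≤ (‖w‖ ^ 2) ^ 2 / ρ * (K * |τ| ^ 4 * (x ^ 2 + y ^ 2))
        + ρ * ∫ z, h z ^ 2 ∂(cellMeasure A) := by
    have hc : (‖w‖ ^ 2) ^ 2 / ρ * (K * |τ| ^ 4 * (x ^ 2 + y ^ 2))
        = ∫ _, (‖w‖ ^ 2) ^ 2 / ρ * (K * |τ| ^ 4 * (x ^ 2 + y ^ 2)) ∂(cellMeasure A) := by simp
    rw [← integral_const_mul, ← integral_const_mul, hc, ← integral_add
      (integrable_cellMeasure (by fun_prop)) (integrable_cellMeasure (by fun_prop))]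
    refine integral_mono (integrable_cellMeasure (by fun_prop))
      (integrable_cellMeasure (by fun_prop)) fun z => ?_
    have t1 := mul_le_mul_of_nonneg_left (hb (phase w z)).2
      (show 0 ≤ (‖w‖ ^ 2) ^ 2 / ρ by positivity)
    have t2 : (‖w‖ ^ 2) ^ 2 / ρ * trialResidual α β ε κ τ x y (phase w z) ^ 2 + ρ * h z ^ 2
        - 2 * ‖w‖ ^ 2 * (trialResidual α β ε κ τ x y (phase w z) * h z)
        = (‖w‖ ^ 2 * trialResidual α β ε κ τ x y (phase w z) - ρ * h z) ^ 2 / ρ := by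
      field_simp; ring
    have t3 : 0 ≤ (‖w‖ ^ 2 * trialResidual α β ε κ τ x y (phase w z) - ρ * h z) ^ 2 / ρ := by
      positivity
    dsimp only
    linarith
  have hmain : 0 ≤ ∫ z, ‖gradient f z‖ ^ 2 * exp (β * τ * sin (phase w z)) ∂(cellMeasure A)
      - 4 * π ^ 2 * ‖w‖ ^ 2 * (1 - κ * τ ^ 2) *
        ∫ z, (f z - m) ^ 2 * exp (α * τ * sin (phase w z)) ∂(cellMeasure A) := by
    simp only [hfm]
    rw [hgrad, hen]
    change 0 ≤ -(4 * π ^ 2 * ‖w‖ ^ 2)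
        * phaseMean A w (fun u => trialResidual α β ε κ τ x y u * trial α ε τ x y u)
      - 2 * (4 * π ^ 2 * ‖w‖ ^ 2)
        * ∫ z, trialResidual α β ε κ τ x y (phase w z) * h z ∂(cellMeasure A) + _
    set T := phaseMean A w (fun u => trialResidual α β ε κ τ x y u * trial α ε τ x y u)
    set J := ∫ z, trialResidual α β ε κ τ x y (phase w z) * h z ∂(cellMeasure A)
    set H := ∫ z, h z ^ 2 ∂(cellMeasure A)
    have s1 : 0 ≤ ‖w‖ ^ 2 * τ ^ 2 * (x ^ 2 + y ^ 2)
        * (q - K * |τ| - K * τ ^ 2 * (‖w‖ ^ 2 / ρ)) := by positivity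
    have s2 : ρ * H ≤ (Λ * exp (-|β * τ|) - ‖w‖ ^ 2 * exp |α * τ|) * H := by
      gcongr; linarith
    have s3 := mul_le_mul_of_nonneg_left hRL (sq_nonneg ‖w‖)
    have s4 : ‖w‖ ^ 2 * (-(q * τ ^ 2 * (x ^ 2 + y ^ 2)) + K * |τ| ^ 3 * (x ^ 2 + y ^ 2))
        + (‖w‖ ^ 2) ^ 2 / ρ * (K * |τ| ^ 4 * (x ^ 2 + y ^ 2))
        = -(‖w‖ ^ 2 * τ ^ 2 * (x ^ 2 + y ^ 2)
          * (q - K * |τ| - K * τ ^ 2 * (‖w‖ ^ 2 / ρ))) := by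
      have a3 : |τ| ^ 3 = τ ^ 2 * |τ| := by rw [← sq_abs τ]; ring
      have a4 : |τ| ^ 4 = τ ^ 4 := Even.pow_abs (by decide) τ
      rw [a3, a4]
      ring
    have s5 : 0 ≤ 4 * π ^ 2 * (-(‖w‖ ^ 2 * T) - 2 * ‖w‖ ^ 2 * J
        + (Λ * exp (-|β * τ|) - ‖w‖ ^ 2 * exp |α * τ|) * H) := by
      have : 0 ≤ -(‖w‖ ^ 2 * T) - 2 * ‖w‖ ^ 2 * J
        + (Λ * exp (-|β * τ|) - ‖w‖ ^ 2 * exp |α * τ|) * H := by linarith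
      positivity
    linarith
  have hμ : 0 ≤ 4 * π ^ 2 * ‖w‖ ^ 2 * (1 - κ * τ ^ 2) := by positivity
  have := mul_le_mul_of_nonneg_left hvar hμ
  linarith

end Perturbation

section Final

variable {n : ℕ} {A : Matrix (Fin n) (Fin n) ℝ} {w : E n}

lemma integral_cellMeasure_pos (hA : IsUnit A.det) {g : E n → ℝ} (hc : Continuous g)
    (hper : IsPeriodic (lattice A) g) (h0 : ∀ x, 0 ≤ g x) {x₀ : E n} (hx₀ : g x₀ ≠ 0) :
    0 < ∫ x, g x ∂(cellMeasure A) := by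
  set v := x₀ - matVec A (fun _ => 1 / 2) with hv
  rw [← integral_cellMeasure_add hA hc hper v, integral_cellMeasure (by fun_prop)]
  set G : (Fin n → ℝ) → ℝ := fun t => g (matVec A t + v) with hG
  have hGc : Continuous G := hc.comp (continuous_matVec.add continuous_const)
  have hGi : IntegrableOn G (unitCube n) := by
    refine (hGc.continuousOn.integrableOn_compact (isCompact_univ_pi fun _ : Fin n =>
      isCompact_Icc (a := (0 : ℝ)) (b := 1))).mono_set ?_
    rw [unitCube_eq_pi]
    exact Set.pi_mono fun _ _ => Set.Ioc_subset_Icc_self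
  rw [setIntegral_pos_iff_support_of_nonneg_ae (Eventually.of_forall fun t => h0 _) hGi]
  have hopen : IsOpen (Function.support G ∩ Set.univ.pi fun _ => Set.Ioo (0 : ℝ) 1) :=
    (hGc.isOpen_support).inter (isOpen_set_pi Set.finite_univ fun _ _ => isOpen_Ioo)
  refine (hopen.measure_pos volume ⟨fun _ => 1 / 2, ?_, fun _ _ => by norm_num⟩).trans_le
    (measure_mono (Set.inter_subset_inter_right _ ?_))
  · simpa [hG, hv] using hx₀
  · rw [unitCube_eq_pi]
    exact Set.pi_mono fun _ _ => Set.Ioo_subset_Ioc_self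

lemma exists_admissible (hw : w ∈ dualLattice (lattice A))
    (hw0 : w ≠ 0) {Q : E n → ℝ} (hQ : Continuous Q) (hQ0 : 0 < ∫ x, Q x ∂(cellMeasure A)) :
    ∃ f : E n → ℝ, ContDiff ℝ (⊤ : ℕ∞) f ∧ IsPeriodic (lattice A) f ∧ f ≠ 0 ∧
      ∫ x, f x * Q x ∂(cellMeasure A) = 0 := by
  set m := (∫ x, cos (phase w x) * Q x ∂(cellMeasure A)) / ∫ x, Q x ∂(cellMeasure A) with hm
  refine ⟨fun x => cos (phase w x) - m, (contDiff_cos.comp contDiff_phase).sub contDiff_const,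
    isPeriodic_comp_phase (ψ := fun u => cos u - m) hw (fun u => by simp), fun h => ?_, ?_⟩
  · have h1 := congrFun h 0
    have h2 := congrFun h ((2 * ‖w‖ ^ 2)⁻¹ • w)
    have hw' : ‖w‖ ≠ 0 := norm_ne_zero_iff.mpr hw0
    have e : phase w ((2 * ‖w‖ ^ 2)⁻¹ • w) = π := by
      rw [phase, inner_smul_right, real_inner_self_eq_norm_sq]
      field_simp
    have e0 : phase w 0 = 0 := by simp [phase]
    simp only [e, e0, Pi.zero_apply, cos_pi, cos_zero] at h1 h2
    linarith
  · simp only [sub_mul]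
    rw [integral_sub (integrable_cellMeasure (by fun_prop)) (integrable_cellMeasure (by fun_prop)),
      integral_const_mul, hm, div_mul_cancel₀ _ hQ0.ne', sub_self]

lemma le_phaseMean_exp_mul_sin (hA : IsUnit A.det) (hw : w ∈ dualLattice (lattice A))
    (hw0 : w ≠ 0) {a : ℝ} (ha : |a| ≤ 1) :
    1 + a ^ 2 / 4 - |a| ^ 3 ≤ phaseMean A w (fun u => exp (a * sin u)) := by
  have h : ∀ u, (1 - |a| ^ 3) + a * sin u + a ^ 2 / 2 * sin u ^ 2 ≤ exp (a * sin u) := by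
    intro u
    have hz : |a * sin u| ≤ |a| := by
      rw [abs_mul]; exact mul_le_of_le_one_right (abs_nonneg _) (Real.abs_sin_le_one u)
    obtain ⟨ρ, hρ, e⟩ := exists_exp_eq_cubic (hz.trans ha)
    have h1 : |(a * sin u) ^ 3 * ρ| ≤ |a| ^ 3 := by
      rw [abs_mul, abs_pow]
      calc |a * sin u| ^ 3 * |ρ| ≤ |a| ^ 3 * 1 := by gcongr
        _ = |a| ^ 3 := mul_one _
    rw [e]
    have := neg_abs_le ((a * sin u) ^ 3 * ρ)
    nlinarith
  refine le_trans (le_of_eq ?_) (phaseMean_mono (by fun_prop) (by fun_prop) h)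
  rw [phaseMean_add (by fun_prop) (by fun_prop), phaseMean_add (by fun_prop) (by fun_prop),
    phaseMean_const_mul, phaseMean_const_mul, phaseMean_const, phaseMean_sin hA hw hw0,
    phaseMean_sin_sq hA hw hw0]
  ring

lemma one_lt_mul_rpow_two_div {x v r : ℝ} (hr : 2 ≤ r) (hx : 0 ≤ 1 - x) (hv : 0 ≤ v)
    (h : 1 < (1 - r / 2 * x) * v) : 1 < (1 - x) * v ^ (2 / r) := by
  have hB : 1 - r / 2 * x ≤ (1 - x) ^ (r / 2) := by
    have := one_add_mul_self_le_rpow_one_add (s := -x) (by linarith) (p := r / 2) (by linarith)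
    simpa [sub_eq_add_neg] using this
  have h1 : 1 < (1 - x) ^ (r / 2) * v := h.trans_le (mul_le_mul_of_nonneg_right hB hv)
  have h2 := Real.one_lt_rpow h1 (z := 2 / r) (by positivity)
  rwa [Real.mul_rpow (by positivity) hv, ← Real.rpow_mul hx, div_mul_div_cancel₀ (by norm_num),
    div_self (by linarith), Real.rpow_one] at h2

end Final

/-- Under the gap condition, the flat metric `g_Γ` is not a maximal point of the normalized
first eigenvalue in its conformal class: with `φ = u₁`, arbitrarily close to `t = 0` there
are `t ≠ 0` with `λ₁(t)·V_φ(t)^{2/n} > 4π²|w|²·D^{2/n}`. -/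
theorem statement10 (n : ℕ) (hn : 2 ≤ n) (A : Matrix (Fin n) (Fin n) ℝ) (hA : IsUnit A.det)
    (w : E n) (hgap : GapCondition (lattice A) w)
    (φ : E n → ℝ) (hφ : φ = uSin A w) :
    ∀ ε > (0 : ℝ), ∃ t : ℝ, 0 < |t| ∧ |t| < ε ∧
      confLam1 A φ t * confVol A φ t ^ ((2 : ℝ) / n)
        > 4 * π ^ 2 * ‖w‖ ^ 2 * |A.det| ^ ((2 : ℝ) / n) := by
  intro ε hε
  have hn' : (2 : ℝ) ≤ n := by exact_mod_cast hn
  have hw := hgap.1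
  have hw0 := hgap.2.1
  have hD : 0 < |A.det| := abs_pos.mpr hA.ne_zero
  obtain ⟨ν, hν⟩ : ∃ ν : ℝ, ν = n := ⟨_, rfl⟩
  rw [← hν] at hn' ⊢
  obtain ⟨κ, hκ⟩ : ∃ κ : ℝ, κ = ν / 8 - 1 / 48 := ⟨_, rfl⟩
  obtain ⟨c, hc⟩ : ∃ c : ℝ, c = √2 / √|A.det| := ⟨_, rfl⟩
  have hc0 : 0 < c := by rw [hc]; positivity
  have hexp : ∀ a t x, a * t * φ x / 2 = a / 2 * (t * c) * sin (phase w x) := by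
    intro a t x
    rw [hφ, uSin, ← hc, phase]
    ring
  have hE := eventually_weighted_eigenvalue_bound hA hgap (α := ν / 2) (β := (ν - 2) / 2)
    (ε := (ν - 4) / 12) (κ := κ) (q := 1 / 96) (by ring) (by rw [hκ]; linarith) (by norm_num)
    (by rw [hκ]; nlinarith) (by rw [hκ]; nlinarith)
  have ev : ∀ F : ℝ → ℝ, Continuous F → 0 < F 0 → ∀ᶠ τ in 𝓝 0, 0 < F τ := fun F hF h =>
    hF.continuousAt.eventually (lt_mem_nhds h)
  have htend : Tendsto (fun t : ℝ => t * c) (𝓝[>] 0) (𝓝 0) :=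
    ((continuous_id.mul continuous_const).tendsto' 0 0 (by simp)).mono_left nhdsWithin_le_nhds
  have hall := htend.eventually (((hE.and (ev (fun τ => 1 - κ * τ ^ 2) (by fun_prop) (by simp))).and
    ((ev (fun τ => 1 - |ν / 2 * τ|) (by fun_prop) (by simp)).and
      (ev (fun τ => ν ^ 2 / 16 - ν ^ 3 / 8 * |τ|) (by fun_prop) (by simp; positivity)))).and
    (ev (fun τ => ν ^ 2 / 16 - ν ^ 3 / 8 * |τ| - ν * κ / 2
      - ν * κ / 2 * τ ^ 2 * (ν ^ 2 / 16 - ν ^ 3 / 8 * |τ|)) (by fun_prop)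
      (by simp [hκ]; nlinarith)))
  obtain ⟨t, ⟨⟨⟨hE, hμ⟩, ha, hp⟩, hgain⟩, ht0, htε⟩ :=
    (hall.and (Ioo_mem_nhdsGT hε)).exists
  refine ⟨t, by rwa [abs_of_pos ht0], by rwa [abs_of_pos ht0], ?_⟩
  obtain ⟨τ, hτ⟩ : ∃ τ, τ = t * c := ⟨_, rfl⟩
  have hτ0 : 0 < τ := by rw [hτ]; positivity
  rw [← hτ] at hE hμ ha hp hgain
  have hQpos : 0 < ∫ x, exp (ν / 2 * τ * sin (phase w x)) ∂(cellMeasure A) :=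
    integral_exp_pos (integrable_cellMeasure (by fun_prop))
  have hlam : 4 * π ^ 2 * ‖w‖ ^ 2 * (1 - κ * τ ^ 2) ≤ confLam1 A φ t := by
    simp only [confLam1, ← hν, hexp, ← hτ, setIntegral_fundDomain hA, smul_eq_mul]
    refine le_csInf ?_ ?_
    · obtain ⟨f, h1, h2, h3, h4⟩ := exists_admissible (A := A) hw hw0
        (Q := fun x => exp (ν / 2 * τ * sin (phase w x))) (by fun_prop) hQpos
      exact ⟨_, f, h1, h2, h3, by rw [h4, mul_zero], rfl⟩
    · rintro r ⟨f, h1, h2, h3, h4, rfl⟩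
      have hfc := h1.continuous
      obtain ⟨x₀, hx₀⟩ := Function.ne_iff.mp h3
      have hden : 0 < ∫ x, f x ^ 2 * exp (ν / 2 * τ * sin (phase w x)) ∂(cellMeasure A) := by
        refine integral_cellMeasure_pos hA (by fun_prop) (fun x γ hγ => ?_)
          (fun x => by positivity) (x₀ := x₀) (by simpa using hx₀)
        have : exp (ν / 2 * τ * sin (phase w (x + γ))) = exp (ν / 2 * τ * sin (phase w x)) :=
          isPeriodic_comp_phase (ψ := fun u => exp (ν / 2 * τ * sin u)) hw (fun u => by simp)
            x γ hγ
        simp only [this, h2 x γ hγ]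
      rw [mul_div_mul_left _ _ hD.ne', le_div_iff₀ hden]
      exact hE f h1 h2 ((mul_eq_zero.mp h4).resolve_left hD.ne')
  obtain ⟨v, hv⟩ : ∃ v, v = 1 + τ ^ 2 * (ν ^ 2 / 16 - ν ^ 3 / 8 * |τ|) := ⟨_, rfl⟩
  have hv0 : 0 ≤ v := by rw [hv]; positivity
  have hvol : |A.det| * v ≤ confVol A φ t := by
    simp only [confVol, ← hν, hexp, ← hτ, setIntegral_fundDomain hA, smul_eq_mul]
    refine mul_le_mul_of_nonneg_left (le_trans (le_of_eq ?_)
      (le_phaseMean_exp_mul_sin hA hw hw0 (a := ν / 2 * τ) (by linarith))) hD.le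
    rw [hv, abs_mul, abs_of_pos hτ0, abs_of_pos (by linarith : 0 < ν / 2)]
    ring
  have hfinal : 1 < (1 - κ * τ ^ 2) * v ^ (2 / ν) := by
    refine one_lt_mul_rpow_two_div hn' hμ.le hv0 ?_
    have := mul_pos (pow_pos hτ0 2) hgain
    rw [hv]
    nlinarith
  have hw' : 0 < ‖w‖ := norm_pos_iff.mpr hw0
  calc 4 * π ^ 2 * ‖w‖ ^ 2 * |A.det| ^ (2 / ν)
      < 4 * π ^ 2 * ‖w‖ ^ 2 * |A.det| ^ (2 / ν) * ((1 - κ * τ ^ 2) * v ^ (2 / ν)) :=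
        lt_mul_of_one_lt_right (by positivity) hfinal
    _ = 4 * π ^ 2 * ‖w‖ ^ 2 * (1 - κ * τ ^ 2) * (|A.det| * v) ^ (2 / ν) := by
        rw [Real.mul_rpow hD.le hv0]; ring
    _ ≤ confLam1 A φ t * confVol A φ t ^ (2 / ν) := by
        have := Real.rpow_le_rpow (by positivity) hvol (show 0 ≤ 2 / ν by positivity)
        refine mul_le_mul hlam this (by positivity) (le_trans (by positivity) hlam)
end
end

section
/- Let 0 ≤ a ≤ 1/2 and b > 0 with a² + b² ≥ 1, and let Γ_{a,b} := ℤ·(1,0) ⊕ ℤ·(a,b) ⊂ ℝ². Then the dual lattice Γ*_{a,b} satisfies the gap condition — that is, there exists w ∈ Γ*_{a,b} \ {0} with |w| < |v| for every v ∈ Γ*_{a,b} \ {0, w, −w} — if and only if a² + b² > 1. -/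
open MeasureTheory Real Filter Topology Asymptotics
open scoped InnerProductSpace

noncomputable section

/-- The lattice `Γ_{a,b} = ℤ·(1,0) ⊕ ℤ·(a,b)` in `ℝ²`. -/
def latticeAB (a b : ℝ) : Set (E 2) :=
  {x | ∃ m k : ℤ, x = (m : ℝ) • (WithLp.equiv 2 (Fin 2 → ℝ)).symm ![1, 0]
                    + (k : ℝ) • (WithLp.equiv 2 (Fin 2 → ℝ)).symm ![a, b]}

/-- The point of the dual lattice of `latticeAB a b` pairing to `p` with `(1, 0)` and to `q`
with `(a, b)`. -/
def dualPoint (a b : ℝ) (p q : ℤ) : E 2 := !₂[(p : ℝ), (q - a * p) / b]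

theorem mem_dualLattice_latticeAB_iff {a b : ℝ} (hb : b ≠ 0) (w : E 2) :
    w ∈ dualLattice (latticeAB a b) ↔ ∃ p q : ℤ, w = dualPoint a b p q := by
  constructor
  · intro h
    obtain ⟨p, hp⟩ := h _ ⟨1, 0, rfl⟩
    obtain ⟨q, hq⟩ := h _ ⟨0, 1, rfl⟩
    simp [PiLp.inner_apply, Fin.sum_univ_two] at hp hq
    refine ⟨p, q, ?_⟩
    ext i
    fin_cases i
    · simp [dualPoint, hp]
    · simp only [dualPoint, Fin.mk_one, PiLp.toLp_apply, Matrix.cons_val_one,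
        Matrix.cons_val_fin_one]
      rw [eq_div_iff hb, ← hp, ← hq]
      ring
  · rintro ⟨p, q, rfl⟩ _ ⟨m, k, rfl⟩
    refine ⟨m * p + k * q, ?_⟩
    simp [PiLp.inner_apply, Fin.sum_univ_two, dualPoint]
    field_simp
    ring

theorem dualPoint_inj {a b : ℝ} (hb : b ≠ 0) {p q p' q' : ℤ} :
    dualPoint a b p q = dualPoint a b p' q' ↔ p = p' ∧ q = q' := by
  constructor
  · intro h
    have h0 : (p : ℝ) = p' := congrArg (fun v : E 2 => v 0) h
    have h1 : (q - a * p) / b = (q' - a * p') / b := congrArg (fun v : E 2 => v 1) h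
    rw [h0, div_left_inj' hb, sub_left_inj] at h1
    exact ⟨mod_cast h0, mod_cast h1⟩
  · rintro ⟨rfl, rfl⟩
    rfl

theorem dualPoint_zero (a b : ℝ) : dualPoint a b 0 0 = 0 := by
  ext i
  fin_cases i <;> simp [dualPoint]

theorem neg_dualPoint (a b : ℝ) (p q : ℤ) : -dualPoint a b p q = dualPoint a b (-p) (-q) := by
  ext i
  fin_cases i <;> simp [dualPoint]
  ring

theorem norm_dualPoint_lt_iff {a b : ℝ} (hb : 0 < b) {p q p' q' : ℤ} :
    ‖dualPoint a b p q‖ < ‖dualPoint a b p' q'‖ ↔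
      (a ^ 2 + b ^ 2) * p ^ 2 + q ^ 2 - 2 * a * (p * q) <
        (a ^ 2 + b ^ 2) * p' ^ 2 + q' ^ 2 - 2 * a * (p' * q') := by
  have key (m n : ℤ) : (a ^ 2 + b ^ 2) * m ^ 2 + n ^ 2 - 2 * a * (m * n) =
      b ^ 2 * ‖dualPoint a b m n‖ ^ 2 := by
    rw [EuclideanSpace.real_norm_sq_eq, Fin.sum_univ_two]
    simp only [dualPoint, PiLp.toLp_apply, Matrix.cons_val_zero, Matrix.cons_val_one,
      Matrix.cons_val_fin_one]
    field_simp
    ring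
  rw [key, key, mul_lt_mul_iff_right₀ (by positivity), sq_lt_sq₀ (norm_nonneg _) (norm_nonneg _)]

theorem one_le_sq_add_sq_sub {a : ℝ} (ha0 : 0 ≤ a) (ha : a ≤ 1 / 2) {p q : ℤ}
    (h : ¬(p = 0 ∧ q = 0)) : (1 : ℝ) ≤ p ^ 2 + q ^ 2 - 2 * a * (p * q) := by
  have pos : p ≠ 0 ∨ q ≠ 0 := not_and_or.mp h
  have h1 : 0 < p ^ 2 + q ^ 2 := by
    rcases pos with h | h <;> positivity
  have h2 : 0 < p ^ 2 + q ^ 2 - p * q := by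
    nlinarith [sq_nonneg (p - q)]
  have h1' : (1 : ℝ) ≤ p ^ 2 + q ^ 2 := mod_cast h1
  have h2' : (1 : ℝ) ≤ p ^ 2 + q ^ 2 - p * q := mod_cast h2
  nlinarith

/-- For `0 ≤ a ≤ 1/2`, `b > 0`, `a² + b² ≥ 1`, the dual lattice of `Γ_{a,b}` satisfies the
gap condition if and only if `a² + b² > 1`. -/
theorem statement11 (a b : ℝ) (ha0 : 0 ≤ a) (ha : a ≤ 1 / 2) (hb : 0 < b)
    (hab : 1 ≤ a ^ 2 + b ^ 2) :
    (∃ w ∈ dualLattice (latticeAB a b), w ≠ 0 ∧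
        ∀ v ∈ dualLattice (latticeAB a b), v ≠ 0 → v ≠ w → v ≠ -w → ‖w‖ < ‖v‖)
      ↔ 1 < a ^ 2 + b ^ 2 := by
  have hb' := hb.ne'
  simp only [mem_dualLattice_latticeAB_iff hb']
  constructor
  · rintro ⟨_, ⟨p, q, rfl⟩, hw, hmin⟩
    refine lt_of_le_of_ne hab fun hs => ?_
    rw [← dualPoint_zero a b, Ne, dualPoint_inj hb'] at hw
    have hlow := one_le_sq_add_sq_sub ha0 ha hw
    have short (m n : ℤ) (hmn : ¬(m = 0 ∧ n = 0)) (h1 : ¬(m = p ∧ n = q))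
        (h2 : ¬(m = -p ∧ n = -q)) :
        (1 : ℝ) < m ^ 2 + n ^ 2 - 2 * a * (m * n) := by
      have := hmin (dualPoint a b m n) ⟨m, n, rfl⟩
        (by rwa [← dualPoint_zero a b, Ne, dualPoint_inj hb'])
        (by rwa [Ne, dualPoint_inj hb'])
        (by rwa [neg_dualPoint, Ne, dualPoint_inj hb'])
      rw [norm_dualPoint_lt_iff hb, ← hs] at this
      linarith
    by_cases hp : p = 0
    · have := short 1 0 (by simp) (by lia) (by lia)
      norm_num at this
    · have := short 0 1 (by simp) (by lia) (by lia)
      norm_num at this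
  · intro hs
    refine ⟨dualPoint a b 0 1, ⟨0, 1, rfl⟩, ?_, ?_⟩
    · rw [← dualPoint_zero a b, Ne, dualPoint_inj hb']
      simp
    · rintro _ ⟨p, q, rfl⟩ h0 h1 h2
      rw [← dualPoint_zero a b, Ne, dualPoint_inj hb'] at h0
      rw [Ne, dualPoint_inj hb'] at h1
      rw [neg_dualPoint, Ne, dualPoint_inj hb'] at h2
      rw [norm_dualPoint_lt_iff hb]
      by_cases hp : p = 0
      · subst hp
        have hq : 1 < |q| := by grind
        have : (1 : ℝ) < q ^ 2 := mod_cast (one_lt_sq_iff_one_lt_abs q).mpr hq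
        simpa using this
      · have hlow := one_le_sq_add_sq_sub ha0 ha h0
        have hp2 : (0 : ℝ) < p ^ 2 := by positivity
        push_cast
        nlinarith
end
end
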